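/- Let p and q be distinct primes and let 𝔙 be the class of finite groups G whose order is of the form p^α q^β and whose Sylow p-subgroups and Sylow q-subgroups are all abelian of exponent dividing p and q respectively. Then for every natural number n ≥ 1, f_𝔙(n) ≤ n^{d·μ(n) + 2}, where d = max{c_{p,q}, c_{q,p}}. -/

import Mathlib

/-- A group is abelian of exponent dividing `p`. -/
def ElemAbelian (p : ℕ) (G : Type*) [Group G] : Prop :=
  (∀ a b : G, a * b = b * a) ∧ ∀ a : G, a ^ p = 1

/-- `G` lies in the product variety `𝔄_p𝔄_q`: there is a normal subgroup `N` that is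
abelian of exponent dividing `p` such that `G/N` is abelian of exponent dividing `q`
(expressed by: all commutators and all `q`-th powers lie in `N`). -/
def InApAq (p q : ℕ) (G : Type*) [Group G] : Prop :=
  ∃ N : Subgroup G, N.Normal ∧ ElemAbelian p N ∧
    (∀ a b : G, a * b * a⁻¹ * b⁻¹ ∈ N) ∧ ∀ a : G, a ^ q ∈ N

/-- `G` lies in `𝔄_p𝔄_q𝔄_r`: there is a normal subgroup `N`, abelian of exponent
dividing `p`, with `G/N ∈ 𝔄_q𝔄_r`. -/
def InApAqAr (p q r : ℕ) (G : Type*) [Group G] : Prop :=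
  ∃ N : Subgroup G, ∃ _ : N.Normal, ElemAbelian p N ∧ InApAq q r (G ⧸ N)

/-- A Sylow `p`-subgroup: a `p`-subgroup whose index is coprime to `p`. -/
def IsSylow' (p : ℕ) {G : Type*} [Group G] (P : Subgroup G) : Prop :=
  IsPGroup p P ∧ Nat.Coprime P.index p

/-- Two group structures give isomorphic groups. -/
def GroupIsoOf {α β : Type} (g : Group α) (h : Group β) : Prop :=
  letI := g; letI := h; Nonempty (α ≃* β)

/-- The number of isomorphism classes of groups of order `n` lying in the class `S`
(a class of groups closed under isomorphism, given as a predicate on group structures). -/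
noncomputable def numGroups (n : ℕ) (S : (G : Type) → Group G → Prop) : ℕ :=
  Nat.card (Quot fun g h : {g : Group (Fin n) // S (Fin n) g} => GroupIsoOf g.1 h.1)

/-- `μ(n)`: the largest exponent to which a prime divides `n`. -/
def muExp (n : ℕ) : ℕ := n.factorization.support.sup n.factorization

/-- `λ(n)`: the number of prime divisors of `n` counted with multiplicity. -/
def lamExp (n : ℕ) : ℕ := n.factorization.sum fun _ e => e

/-- The constant `c_{p,q} = 1/d − 2√((log p/log q)² + log p/(d·log q)) + 2·log p/log q`,
where `d` is the multiplicative order of `p` modulo `q`.  (The quotients of logarithms do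
not depend on the base of the logarithm.) -/
noncomputable def cpq (p q : ℕ) : ℝ :=
  1 / (orderOf (p : ZMod q) : ℝ)
    - 2 * Real.sqrt ((Real.log p / Real.log q) ^ 2
        + Real.log p / ((orderOf (p : ZMod q) : ℝ) * Real.log q))
    + 2 * (Real.log p / Real.log q)


theorem cpq_key (D r s a k m : ℝ) (hD : 0 ≤ D) (hr : 0 ≤ r)
    (hs : s ^ 2 = r ^ 2 + r * D) (ha : 0 ≤ a) (hk : 0 ≤ k) (hm : m ≤ a * D) :
    k * (m - k) ≤ (D - 2 * s + 2 * r) * a * (a * r + k) := by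
  have h1 : k * (m - k) ≤ k * (a * D - k) := by gcongr
  refine h1.trans ?_
  have : (D - 2 * s + 2 * r) * a * (a * r + k) - k * (a * D - k) = (a * r + k - a * s) ^ 2 := by
    have : (a * r + k - a * s) ^ 2 = (a * r + k) ^ 2 - 2 * a * s * (a * r + k) + a ^ 2 * s ^ 2 := by ring
    rw [this, hs]; ring
  nlinarith [sq_nonneg (a * r + k - a * s)]

theorem cpq_bound (p q : ℕ) (hp : p.Prime) (hq : q.Prime) (a k : ℕ) :
    ((k * (a / orderOf (p : ZMod q) - k) : ℕ) : ℝ) * Real.log q ≤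
      cpq p q * a * (a * Real.log p + k * Real.log q) := by
  have hlp : 0 < Real.log p := Real.log_pos (by exact_mod_cast hp.one_lt)
  have hlq : 0 < Real.log q := Real.log_pos (by exact_mod_cast hq.one_lt)
  set d := orderOf (p : ZMod q) with hd
  set r := Real.log p / Real.log q with hr
  have hr0 : 0 ≤ r := by positivity
  set s := Real.sqrt (r ^ 2 + Real.log p / ((d : ℝ) * Real.log q)) with hs
  have hs2 : s ^ 2 = r ^ 2 + r * (1 / (d : ℝ)) := by
    rw [hs, Real.sq_sqrt (by positivity), hr]
    congr 1
    rw [div_mul_div_comm, mul_one, mul_comm (d : ℝ)]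
  have hc : cpq p q = 1 / (d : ℝ) - 2 * s + 2 * r := rfl
  have hm : ((a / d : ℕ) : ℝ) ≤ a * (1 / (d : ℝ)) := by
    rw [mul_one_div]; exact Nat.cast_div_le
  have key := cpq_key (1 / (d : ℝ)) r s a k _ (by positivity) hr0 hs2 (by positivity) (by positivity) hm
  have e1 : Real.log p = r * Real.log q := by rw [hr]; field_simp
  rw [← hc] at key
  have h3 : cpq p q * a * (a * Real.log p + k * Real.log q)
      = (cpq p q * a * (a * r + k)) * Real.log q := by rw [e1]; ring
  rw [h3]
  refine mul_le_mul_of_nonneg_right ?_ hlq.le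
  rcases le_or_gt k (a / d) with h | h
  · push_cast [Nat.cast_sub h]; exact key
  · rw [Nat.sub_eq_zero_of_le h.le]
    have key0 := cpq_key (1 / (d : ℝ)) r s a 0 0 (by positivity) hr0 hs2 (by positivity) (by positivity) (by positivity)
    have : 0 ≤ cpq p q := by
      have key1 := cpq_key (1 / (d : ℝ)) r s 1 0 0 (by positivity) hr0 hs2 (by positivity) (by positivity) (by positivity)
      rw [← hc] at key1
      have : 0 < r := by positivity
      simp at key1
      exact nonneg_of_mul_nonneg_left key1 this
    simp; positivity

theorem cpq_nonneg (p q : ℕ) (hp : p.Prime) (hq : q.Prime) : 0 ≤ cpq p q := by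
  have h := cpq_bound p q hp hq 1 0
  have hlp : 0 < Real.log p := Real.log_pos (by exact_mod_cast hp.one_lt)
  simp at h
  exact nonneg_of_mul_nonneg_left h hlp

/-- Every subspace of `F^m` is a graph over a coordinate subspace. -/
theorem exists_graph {F : Type} [Field F] {m : ℕ} (U : Submodule F (Fin m → F)) :
    ∃ (S : Finset (Fin m)) (M : (Sᶜ : Finset (Fin m)) → S → F), S.card = Module.finrank F U ∧
      ∀ x, x ∈ U ↔ ∀ i : (Sᶜ : Finset (Fin m)), x i = ∑ j, M i j * x j := by
  classical
  let c : Fin m → Module.Dual F U := fun i => (LinearMap.proj i).comp U.subtype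
  have hspan : Submodule.span F (Set.range c) = ⊤ := by
    have := Subspace.dualCoannihilator_dualAnnihilator_eq (W := Submodule.span F (Set.range c))
    rw [← this]
    have h0 : (Submodule.span F (Set.range c)).dualCoannihilator = ⊥ := by
      rw [eq_bot_iff]
      intro x hx
      rw [Submodule.mem_dualCoannihilator] at hx
      rw [Submodule.mem_bot]
      ext i
      exact hx (c i) (Submodule.subset_span ⟨i, rfl⟩)
    rw [h0, Submodule.dualAnnihilator_bot]
  obtain ⟨κ, a, ha, hsp, hli⟩ := exists_linearIndependent' F c
  have : Finite κ := Finite.of_injective a ha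
  have : Fintype κ := Fintype.ofFinite κ
  let S : Finset (Fin m) := Finset.univ.image a
  have hcS : LinearIndependent F (fun j : S => c j) := by
    let e : κ ≃ S := Equiv.ofBijective (fun k => ⟨a k, Finset.mem_image_of_mem a (Finset.mem_univ k)⟩)
      ⟨fun x y h => ha (congrArg Subtype.val h), fun ⟨x, hx⟩ => by
        obtain ⟨k, -, hk⟩ := Finset.mem_image.1 hx
        exact ⟨k, Subtype.ext hk⟩⟩
    exact (linearIndependent_equiv' e (by rfl)).1 hli
  have hspS : ⊤ ≤ Submodule.span F (Set.range (fun j : S => c j)) := by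
    rw [← hspan, ← hsp]
    apply Submodule.span_mono
    rintro _ ⟨k, rfl⟩
    exact ⟨⟨a k, Finset.mem_image_of_mem a (Finset.mem_univ k)⟩, rfl⟩
  let B : Module.Basis S F (Module.Dual F U) := Module.Basis.mk hcS hspS
  have hcard : S.card = Module.finrank F U := by
    rw [← Subspace.dual_finrank_eq, Module.finrank_eq_card_basis B, Fintype.card_coe]
  let M : (Sᶜ : Finset (Fin m)) → S → F := fun i j => B.repr (c i) j
  have hM : ∀ x : Fin m → F, x ∈ U → ∀ i : (Sᶜ : Finset (Fin m)), x i = ∑ j, M i j * x j := by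
    intro x hx i
    have := congrArg (fun f : Module.Dual F U => f ⟨x, hx⟩) (B.sum_repr (c i))
    simp [B, c] at this
    rw [← this]
    rfl
  refine ⟨S, M, hcard, fun x => ⟨hM x, fun hx => ?_⟩⟩
  -- surjectivity of restriction
  let ρ : U →ₗ[F] (S → F) := LinearMap.pi (fun j => c j)
  have hinj : Function.Injective ρ := by
    rw [← LinearMap.ker_eq_bot, eq_bot_iff]
    rintro ⟨u, hu⟩ h
    rw [LinearMap.mem_ker] at h
    rw [Submodule.mem_bot]
    have h1 : ∀ j : S, u j = 0 := fun j => congrFun h j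
    ext i
    by_cases hi : i ∈ S
    · exact h1 ⟨i, hi⟩
    · have := hM u hu ⟨i, by simpa using hi⟩
      simpa [h1] using this
  have hsurj : Function.Surjective ρ :=
    (LinearMap.injective_iff_surjective_of_finrank_eq_finrank (by simp [hcard])).1 hinj
  obtain ⟨⟨u, hu⟩, h⟩ := hsurj (fun j => x j)
  have h1 : ∀ j : S, u j = x j := fun j => congrFun h j
  have : x = u := by
    ext i
    by_cases hi : i ∈ S
    · exact (h1 ⟨i, hi⟩).symm
    · rw [hM u hu ⟨i, by simpa using hi⟩, hx ⟨i, by simpa using hi⟩]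
      simp [h1]
  rw [this]; exact hu

theorem card_subspaces (q : ℕ) [Fact q.Prime] (m K : ℕ) (B : ℝ)
    (hB : ∀ k ≤ K, ((q ^ (k * (m - k)) : ℕ) : ℝ) ≤ B) :
    (Nat.card {U : Submodule (ZMod q) (Fin m → ZMod q) // Module.finrank (ZMod q) U ≤ K} : ℝ)
      ≤ 2 ^ m * B := by
  classical
  choose S M hS hU using fun U : Submodule (ZMod q) (Fin m → ZMod q) => exists_graph U
  let f : {U : Submodule (ZMod q) (Fin m → ZMod q) // Module.finrank (ZMod q) U ≤ K} →
    Σ S : {S : Finset (Fin m) // S.card ≤ K}, ((S.1ᶜ : Finset (Fin m)) → S.1 → ZMod q) :=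
      fun U => ⟨⟨S U.1, (hS U.1).le.trans U.2⟩, M U.1⟩
  have hf : Function.Injective f := by
    rintro ⟨U, h1⟩ ⟨U', h2⟩ h
    have key : ∀ (S' : Finset (Fin m)) (M' : (S'ᶜ : Finset (Fin m)) → S' → ZMod q)
      (T' : Finset (Fin m)) (N' : (T'ᶜ : Finset (Fin m)) → T' → ZMod q) (hs : S'.card ≤ K) (ht : T'.card ≤ K),
      (⟨⟨S', hs⟩, M'⟩ : Σ S : {S : Finset (Fin m) // S.card ≤ K}, ((S.1ᶜ : Finset (Fin m)) → S.1 → ZMod q)) = ⟨⟨T', ht⟩, N'⟩ →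
      ∀ x : Fin m → ZMod q, (∀ i : (S'ᶜ : Finset (Fin m)), x i = ∑ j, M' i j * x j) ↔
        (∀ i : (T'ᶜ : Finset (Fin m)), x i = ∑ j, N' i j * x j) := by
      intro S' M' T' N' hs ht h x
      cases h
      rfl
    apply Subtype.ext
    ext x
    change x ∈ U ↔ x ∈ U'
    rw [hU, hU]
    exact key _ _ _ _ _ _ h x
  have h1 := Nat.card_le_card_of_injective f hf
  have hB0 : 0 ≤ B := le_trans (by positivity) (hB 0 (Nat.zero_le _))
  calc _ ≤ (Nat.card (Σ S : {S : Finset (Fin m) // S.card ≤ K}, ((S.1ᶜ : Finset (Fin m)) → S.1 → ZMod q)) : ℝ) := by exact_mod_cast h1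
    _ = ∑ S : {S : Finset (Fin m) // S.card ≤ K}, ((q ^ (S.1.card * (m - S.1.card)) : ℕ) : ℝ) := by
      rw [Nat.card_sigma]
      push_cast
      refine Finset.sum_congr rfl fun S _ => ?_
      rw [Nat.card_eq_fintype_card]
      simp only [Fintype.card_fun, ZMod.card, Fintype.card_coe, Finset.card_compl, Fintype.card_fin]
      push_cast
      rw [← pow_mul]
    _ ≤ ∑ S : {S : Finset (Fin m) // S.card ≤ K}, B := Finset.sum_le_sum fun S _ => hB _ S.2
    _ = (Fintype.card {S : Finset (Fin m) // S.card ≤ K}) * B := by simp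
    _ ≤ 2 ^ m * B := by
      refine mul_le_mul_of_nonneg_right ?_ hB0
      have := Fintype.card_subtype_le (fun S : Finset (Fin m) => S.card ≤ K)
      rw [Fintype.card_finset, Fintype.card_fin] at this
      exact_mod_cast this

/-- The standard action of `F_q^m` on `K^m × F_p^r` through a character `κ` of `F_q`. -/
def stdAct {p q : ℕ} {K : Type} [Field K] (κ : Multiplicative (ZMod q) →* Kˣ) {m r : ℕ}
    (t : Fin m → ZMod q) (x : (Fin m → K) × (Fin r → ZMod p)) : (Fin m → K) × (Fin r → ZMod p) :=
  (fun i => (κ (Multiplicative.ofAdd (t i)) : K) * x.1 i, x.2)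

theorem field_case {p q : ℕ} [Fact p.Prime] [Fact q.Prime] (hpq : p ≠ q)
    {K : Type} [Field K] [Fintype K] (hK : Fintype.card K = p ^ orderOf (p : ZMod q))
    (κ : Multiplicative (ZMod q) →* Kˣ) (hκ : Function.Injective κ)
    {E : Type} [AddCommGroup E] [Module (ZMod q) E]
    {L : Type} [Field L] [Finite L] [CharP L p] (g : Multiplicative E →* L)
    (hg : ∀ σ : L →+* L, (∀ e, σ (g e) = g e) → σ = RingHom.id L)
    (hne : ∃ e, g e ≠ 1) :
    ∃ (f : L ≃+* K) (χ : E →+ ZMod q), ∀ e : E, f (g (Multiplicative.ofAdd e)) =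
      (κ (Multiplicative.ofAdd (χ e)) : K) := by
  classical
  have hp := Fact.out (p := p.Prime)
  have hq := Fact.out (p := q.Prime)
  set d := orderOf (p : ZMod q) with hd
  have hgq : ∀ e, g e ^ q = 1 := by
    intro e
    rw [← map_pow]
    have : e ^ q = 1 := by
      apply Multiplicative.toAdd.injective
      rw [toAdd_pow, toAdd_one, ← Nat.cast_smul_eq_nsmul (ZMod q)]
      simp
    rw [this, map_one]
  have hpd : (p : ZMod q) ^ d = 1 := pow_orderOf_eq_one _
  have hd0 : 0 < d := by
    have hu : IsUnit (p : ZMod q) := by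
      rw [ZMod.isUnit_iff_coprime]
      exact (Nat.coprime_primes hp hq).2 hpq
    obtain ⟨u, hu⟩ := hu
    rw [hd, ← hu, orderOf_units]
    exact orderOf_pos u
  obtain ⟨t, ht⟩ : ∃ t, p ^ d = q * t + 1 := by
    have h1 : q ∣ p ^ d - 1 := by
      rw [← ZMod.natCast_eq_zero_iff, Nat.cast_sub (Nat.one_le_pow _ _ hp.pos)]
      simp [hpd]
    obtain ⟨t, ht⟩ := h1
    refine ⟨t, ?_⟩
    have := Nat.one_le_pow d p hp.pos
    omega
  have hfix : ∀ x : L, x ^ p ^ d = x := by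
    intro x
    have := hg (iterateFrobenius L p d) (fun e => by
      rw [iterateFrobenius_def, ht, pow_succ, pow_mul, hgq, one_pow, one_mul])
    have := congrArg (fun σ : L →+* L => σ x) this
    simpa [iterateFrobenius_def] using this
  have : Fintype L := Fintype.ofFinite L
  obtain ⟨f, -, hf⟩ := FiniteField.card L p
  have hdf : d ∣ (f : ℕ) := by
    obtain ⟨e, he⟩ := hne
    have h0 : g e ≠ 0 := by
      intro h; have := hgq e; rw [h, zero_pow hq.ne_zero] at this; exact zero_ne_one this
    have ho : orderOf (g e) = q := orderOf_eq_prime (hgq e) he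
    have h1 : q ∣ p ^ (f : ℕ) - 1 := by
      rw [← ho, ← hf]
      exact orderOf_dvd_of_pow_eq_one (FiniteField.pow_card_sub_one_eq_one _ h0)
    apply orderOf_dvd_of_pow_eq_one
    rw [← ZMod.natCast_eq_zero_iff, Nat.cast_sub (Nat.one_le_pow _ _ hp.pos)] at h1
    push_cast at h1
    exact sub_eq_zero.1 h1
  have hle : Fintype.card L ≤ p ^ d := by
    have hne0 : (Polynomial.X ^ p ^ d - Polynomial.X : Polynomial L) ≠ 0 :=
      FiniteField.X_pow_card_sub_X_ne_zero L (Nat.one_lt_pow hd0.ne' hp.one_lt)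
    have hdeg := FiniteField.X_pow_card_sub_X_natDegree_eq L (Nat.one_lt_pow hd0.ne' hp.one_lt)
    have h2 : (Finset.univ : Finset L).val ≤ (Polynomial.X ^ p ^ d - Polynomial.X : Polynomial L).roots := by
      rw [Multiset.le_iff_subset (Finset.univ).nodup]
      intro x _
      rw [Polynomial.mem_roots hne0]
      simp [hfix]
    have h3 := Multiset.card_le_card h2
    have h4 := Polynomial.card_roots' (Polynomial.X ^ p ^ d - Polynomial.X : Polynomial L)
    rw [hdeg] at h4
    exact h3.trans h4
  have hfd : (f : ℕ) = d := by
    apply le_antisymm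
    · rw [hf] at hle
      exact (Nat.pow_le_pow_iff_right hp.one_lt).1 hle
    · exact Nat.le_of_dvd f.pos hdf
  let F : L ≃+* K := FiniteField.ringEquivOfCardEq (by rw [hf, hfd, hK])
  -- roots of unity in `K`
  have hroot : ∀ x : K, x ^ q = 1 → ∃ s : ZMod q, (κ (Multiplicative.ofAdd s) : K) = x := by
    intro x hx
    let i : ZMod q → K := fun s => (κ (Multiplicative.ofAdd s) : K)
    have hi : Function.Injective i := fun a b h =>
      Multiplicative.ofAdd.injective (hκ (Units.ext h))
    have h1 : Finset.univ.image i ⊆ Polynomial.nthRootsFinset q (1 : K) := by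
      intro y hy
      obtain ⟨s, -, rfl⟩ := Finset.mem_image.1 hy
      rw [Polynomial.mem_nthRootsFinset hq.pos]
      change ((κ (Multiplicative.ofAdd s) : K)) ^ q = 1
      rw [← Units.val_pow_eq_pow_val, ← map_pow, ← ofAdd_nsmul]
      simp
    have h2 : Finset.univ.image i = Polynomial.nthRootsFinset q (1 : K) := by
      apply Finset.eq_of_subset_of_card_le h1
      rw [Finset.card_image_of_injective _ hi, Finset.card_univ, ZMod.card]
      refine (Multiset.toFinset_card_le _).trans (Polynomial.card_nthRoots q (1:K))
    have h3 : x ∈ Finset.univ.image i := by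
      rw [h2, Polynomial.mem_nthRootsFinset hq.pos]; exact hx
    obtain ⟨s, -, hs⟩ := Finset.mem_image.1 h3
    exact ⟨s, hs⟩
  have hex : ∀ e : E, ∃ s : ZMod q, (κ (Multiplicative.ofAdd s) : K) = F (g (Multiplicative.ofAdd e)) :=
    fun e => hroot _ (by rw [← map_pow, hgq, map_one])
  choose χ hχ using hex
  refine ⟨F, AddMonoidHom.mk' χ ?_, fun e => (hχ e).symm⟩
  intro a b
  apply Multiplicative.ofAdd.injective
  apply hκ
  apply Units.ext
  rw [hχ, ofAdd_add, ofAdd_add, map_mul, map_mul, map_mul, Units.val_mul, hχ, hχ]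

theorem rep_decomp {p q : ℕ} [Fact p.Prime] [Fact q.Prime] (hpq : p ≠ q)
    {K : Type} [Field K] [Fintype K] [Algebra (ZMod p) K]
    (hK : Fintype.card K = p ^ orderOf (p : ZMod q))
    (κ : Multiplicative (ZMod q) →* Kˣ) (hκ : Function.Injective κ)
    {E : Type} [AddCommGroup E] [Module (ZMod q) E] [Finite E] (N : ℕ) :
    ∀ (V : Type) [AddCommGroup V] [Module (MonoidAlgebra (ZMod p) (Multiplicative E)) V] [Finite V],
      Nat.card V ≤ N → ∃ (m r : ℕ), r < orderOf (p : ZMod q) ∧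
        ∃ (ψ : V ≃+ (Fin m → K) × (Fin r → ZMod p)) (χ : E →+ (Fin m → ZMod q)),
          ∀ (e : E) (v : V),
            ψ (MonoidAlgebra.of (ZMod p) (Multiplicative E) (Multiplicative.ofAdd e) • v) =
              stdAct κ (χ e) (ψ v) := by
  classical
  have hp := Fact.out (p := p.Prime)
  have hq := Fact.out (p := q.Prime)
  set d := orderOf (p : ZMod q) with hd
  have hd0 : 0 < d := by
    have hu : IsUnit (p : ZMod q) := by
      rw [ZMod.isUnit_iff_coprime]
      exact (Nat.coprime_primes hp hq).2 hpq
    obtain ⟨u, hu⟩ := hu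
    rw [hd, ← hu, orderOf_units]
    exact orderOf_pos u
  have hKd : Module.finrank (ZMod p) K = d := by
    have := Module.card_eq_pow_finrank (K := ZMod p) (V := K)
    rw [hK, ZMod.card] at this
    exact (Nat.pow_right_injective hp.two_le this).symm
  have hcardE : NeZero (Nat.card (Multiplicative E) : ZMod p) := by
    constructor
    intro h
    rw [ZMod.natCast_eq_zero_iff] at h
    have h1 : Nat.card (Multiplicative E) = Nat.card E := rfl
    have : Fintype E := Fintype.ofFinite E
    rw [h1, Nat.card_eq_fintype_card, Module.card_eq_pow_finrank (K := ZMod q) (V := E), ZMod.card] at h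
    exact hpq ((Nat.prime_dvd_prime_iff_eq hp hq).1 (hp.dvd_of_dvd_pow h))
  induction N with
  | zero =>
    intro V _ _ _ h
    have := Nat.card_pos (α := V)
    omega
  | succ N ih =>
    intro V _ _ _ hN
    let of := MonoidAlgebra.of (ZMod p) (Multiplicative E)
    by_cases htriv : ∀ (e : Multiplicative E) (v : V), of e • v = v
    · let : Module (ZMod p) V := Module.compHom V (algebraMap (ZMod p) (MonoidAlgebra (ZMod p) (Multiplicative E)))
      let a := Module.finrank (ZMod p) V
      have : Module.finrank (ZMod p) V =
          Module.finrank (ZMod p) ((Fin (a / d) → K) × (Fin (a % d) → ZMod p)) := by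
        rw [Module.finrank_prod, Module.finrank_pi_fintype, Module.finrank_fin_fun]
        simp only [hKd, Finset.sum_const, Finset.card_univ, Fintype.card_fin, smul_eq_mul]
        rw [Nat.div_add_mod']
      let ψ := LinearEquiv.ofFinrankEq V ((Fin (a / d) → K) × (Fin (a % d) → ZMod p)) this
      refine ⟨a / d, a % d, Nat.mod_lt _ hd0, ψ.toAddEquiv, 0, fun e v => ?_⟩
      rw [htriv]
      ext i <;> simp [stdAct]
    · push Not at htriv
      obtain ⟨e0, v0, h0⟩ := htriv
      let R := MonoidAlgebra (ZMod p) (Multiplicative E)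
      let Fx : Submodule R V :=
        { carrier := {v | ∀ e : Multiplicative E, of e • v = v}
          add_mem' := by
            intro a b ha hb e
            rw [smul_add, ha e, hb e]
          zero_mem' := by intro e; simp
          smul_mem' := by
            intro c x hx e
            rw [smul_smul, mul_comm, ← smul_smul, hx e] }
      obtain ⟨W, hW⟩ := exists_isCompl Fx
      have hWne : W ≠ ⊥ := by
        intro h
        rw [h] at hW
        have := hW.sup_eq_top
        rw [sup_bot_eq] at this
        have h1 : v0 ∈ Fx := by rw [this]; trivial
        exact h0 (h1 e0)
      obtain ⟨S, hS, hSW⟩ := (eq_bot_or_exists_atom_le W).resolve_left hWne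
      obtain ⟨W', hW'⟩ := exists_isCompl S
      have hSs : IsSimpleModule R S := isSimpleModule_iff_isAtom.2 hS
      obtain ⟨I, hI, ⟨ε⟩⟩ := isSimpleModule_iff_quot_maximal.1 hSs
      let : Field (R ⧸ I) := Ideal.Quotient.field I
      have : Finite (R ⧸ I) := Finite.of_equiv S ε.toEquiv
      have hch : CharP (R ⧸ I) p := by
        have := charP_of_injective_algebraMap (RingHom.injective (algebraMap (ZMod p) (R ⧸ I))) p
        exact this
      obtain ⟨f, χ, hχ⟩ := field_case hpq hK κ hκ (E := E) (L := R ⧸ I)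
        ((Ideal.Quotient.mk I : R →* R ⧸ I).comp of) (by
          intro σ hσ
          have : σ.comp (Ideal.Quotient.mk I) = Ideal.Quotient.mk I := by
            apply MonoidAlgebra.ringHom_ext'
            · exact Subsingleton.elim _ _
            · ext e
              exact hσ e
          apply RingHom.ext
          intro x
          obtain ⟨y, rfl⟩ := Ideal.Quotient.mk_surjective x
          exact congrArg (fun τ : R →+* R ⧸ I => τ y) this) (by
          by_contra hcon
          push Not at hcon
          apply hS.1
          rw [eq_bot_iff]
          intro s hs
          have : s ∈ Fx := by
            intro e
            have h1 : (of e • (⟨s, hs⟩ : S)) = ⟨s, hs⟩ := by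
              apply ε.injective
              rw [map_smul]
              have h2 := hcon e
              obtain ⟨y, hy⟩ := Ideal.Quotient.mk_surjective (ε ⟨s, hs⟩)
              rw [← hy]
              change Ideal.Quotient.mk I (of e * y) = _
              rw [map_mul]
              change Ideal.Quotient.mk I (of e) = 1 at h2
              rw [h2, one_mul]
            exact congrArg Subtype.val h1
          have h3 : s ∈ Fx ⊓ W := ⟨this, hSW hs⟩
          rw [hW.inf_eq_bot] at h3
          exact h3)
      have hcard : Nat.card W' ≤ N := by
        have e1 := Nat.card_congr (Submodule.prodEquivOfIsCompl S W' hW').toEquiv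
        rw [Nat.card_prod] at e1
        have : Nontrivial S := IsSimpleModule.nontrivial R S
        have h2 : 2 ≤ Nat.card S := Finite.one_lt_card
        have h3 : 0 < Nat.card W' := Nat.card_pos
        nlinarith
      obtain ⟨m, r, hr, ψ, χ', hψ⟩ := ih W' hcard
      let Ψ : V ≃+ (S × W') := (Submodule.prodEquivOfIsCompl S W' hW').symm.toAddEquiv
      have hΨ : ∀ (x : R) v, Ψ (x • v) = x • Ψ v := fun x v =>
        (Submodule.prodEquivOfIsCompl S W' hW').symm.map_smul x v
      let g1 : S ≃+ K := ε.toAddEquiv.trans f.toAddEquiv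
      let T : K × ((Fin m → K) × (Fin r → ZMod p)) ≃+ (Fin (m+1) → K) × (Fin r → ZMod p) :=
        { toFun := fun x => (Fin.cons x.1 x.2.1, x.2.2)
          invFun := fun y => (y.1 0, (Fin.tail y.1, y.2))
          left_inv := fun x => by simp
          right_inv := fun y => by simp
          map_add' := fun x y => by
            ext i
            · refine Fin.cases ?_ (fun j => ?_) i <;> simp
            · simp }
      let X : E →+ (Fin (m+1) → ZMod q) :=
        { toFun := fun e => Fin.cons (χ e) (χ' e)
          map_zero' := by
            ext i; refine Fin.cases ?_ (fun j => ?_) i <;> simp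
          map_add' := fun a b => by
            ext i; refine Fin.cases ?_ (fun j => ?_) i <;> simp }
      refine ⟨m + 1, r, hr, Ψ.trans ((AddEquiv.prodCongr g1 ψ).trans T), X, fun e v => ?_⟩
      have hg1 : ∀ s : S, g1 (of (Multiplicative.ofAdd e) • s) = (κ (Multiplicative.ofAdd (χ e)) : K) * g1 s := by
        intro s
        rw [← hχ]
        change f (ε _) = f _ * f (ε _)
        rw [map_smul, ← map_mul]
        congr 1
      have hv : Ψ (of (Multiplicative.ofAdd e) • v) = (of (Multiplicative.ofAdd e) • (Ψ v).1, of (Multiplicative.ofAdd e) • (Ψ v).2) := hΨ _ _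
      change T (g1 (Ψ (of (Multiplicative.ofAdd e) • v)).1, ψ (Ψ (of (Multiplicative.ofAdd e) • v)).2) = stdAct κ (X e) (T (g1 (Ψ v).1, ψ (Ψ v).2))
      rw [hv]
      dsimp only
      rw [hg1, hψ]
      ext i
      · refine Fin.cases ?_ (fun j => ?_) i
        · simp [T, X, stdAct]
        · simp [T, X, stdAct]
      · simp [T, stdAct]

/-- The standard action as a homomorphism into the automorphism group. -/
def stdAut (p : ℕ) {q : ℕ} {K : Type} [Field K] (κ : Multiplicative (ZMod q) →* Kˣ) (m r : ℕ) :
    Multiplicative (Fin m → ZMod q) →* MulAut (Multiplicative ((Fin m → K) × (Fin r → ZMod p))) where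
  toFun t :=
    { toFun := fun x => Multiplicative.ofAdd (stdAct κ t.toAdd x.toAdd)
      invFun := fun x => Multiplicative.ofAdd (stdAct κ (-t.toAdd) x.toAdd)
      left_inv := fun x => by
        apply Multiplicative.toAdd.injective
        ext i <;> simp [stdAct]
      right_inv := fun x => by
        apply Multiplicative.toAdd.injective
        ext i <;> simp [stdAct]
      map_mul' := fun x y => by
        apply Multiplicative.toAdd.injective
        ext i <;> simp [stdAct, mul_add] }
  map_one' := by
    refine MulEquiv.ext fun x => ?_
    apply Multiplicative.toAdd.injective
    ext i <;> simp [stdAct]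
  map_mul' s t := by
    refine MulEquiv.ext fun x => ?_
    apply Multiplicative.toAdd.injective
    ext i <;> simp [stdAct, mul_assoc]

/-- The model group attached to a linear map. -/
abbrev ModelGp (p : ℕ) {q : ℕ} {K : Type} [Field K] (κ : Multiplicative (ZMod q) →* Kˣ) (m r e : ℕ)
    (T : (Fin e → ZMod q) →ₗ[ZMod q] (Fin m → ZMod q)) : Type :=
  SemidirectProduct (Multiplicative ((Fin m → K) × (Fin r → ZMod p)))
    (Multiplicative (Fin e → ZMod q))
    ((stdAut p κ m r).comp (AddMonoidHom.toMultiplicative T.toAddMonoidHom))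

theorem exists_equiv_of_range_eq {F : Type} [Field F] {e m : ℕ} (T T' : (Fin e → F) →ₗ[F] (Fin m → F))
    (h : LinearMap.range T = LinearMap.range T') :
    ∃ g : (Fin e → F) ≃ₗ[F] (Fin e → F), ∀ x, T' (g x) = T x := by
  obtain ⟨C, hC⟩ := exists_isCompl (LinearMap.ker T)
  obtain ⟨C', hC'⟩ := exists_isCompl (LinearMap.ker T')
  have h1 := LinearMap.finrank_range_add_finrank_ker T
  have h2 := LinearMap.finrank_range_add_finrank_ker T'
  have hk : Module.finrank F (LinearMap.ker T) = Module.finrank F (LinearMap.ker T') := by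
    rw [h] at h1; omega
  let ek : LinearMap.ker T ≃ₗ[F] LinearMap.ker T' := LinearEquiv.ofFinrankEq _ _ hk
  -- the restriction of `T` to a complement of the kernel is an isomorphism onto the range
  have aux : ∀ (T : (Fin e → F) →ₗ[F] (Fin m → F)) (C : Submodule F (Fin e → F)),
      IsCompl (LinearMap.ker T) C → ∃ θ : C ≃ₗ[F] LinearMap.range T, ∀ c, (θ c : Fin m → F) = T c := by
    intro T C hC
    refine ⟨LinearEquiv.ofBijective (T.rangeRestrict.comp C.subtype) ⟨?_, ?_⟩, fun c => rfl⟩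
    · rw [← LinearMap.ker_eq_bot, eq_bot_iff]
      rintro ⟨c, hc⟩ hc0
      rw [LinearMap.mem_ker] at hc0
      have h0 : T c = 0 := congrArg Subtype.val hc0
      have : c ∈ LinearMap.ker T ⊓ C := ⟨h0, hc⟩
      rw [hC.inf_eq_bot, Submodule.mem_bot] at this
      rw [Submodule.mem_bot]; exact Subtype.ext this
    · rintro ⟨_, x, rfl⟩
      have : x ∈ LinearMap.ker T ⊔ C := by rw [hC.sup_eq_top]; trivial
      obtain ⟨k, hk, c, hc, rfl⟩ := Submodule.mem_sup.1 this
      refine ⟨⟨c, hc⟩, Subtype.ext ?_⟩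
      have hk0 : T k = 0 := hk
      change T c = T (k + c)
      rw [map_add, hk0, zero_add]
  obtain ⟨θ, hθ⟩ := aux T C hC
  obtain ⟨θ', hθ'⟩ := aux T' C' hC'
  let ec : C ≃ₗ[F] C' := θ.trans ((LinearEquiv.ofEq _ _ h).trans θ'.symm)
  have hec : ∀ c, T' (ec c) = T c := by
    intro c
    rw [← hθ', ← hθ]
    simp [ec]
  let P := Submodule.prodEquivOfIsCompl _ _ hC
  let P' := Submodule.prodEquivOfIsCompl _ _ hC'
  refine ⟨P.symm.trans ((LinearEquiv.prodCongr ek ec).trans P'), fun x => ?_⟩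
  obtain ⟨⟨k, c⟩, rfl⟩ := P.surjective x
  have hk0 : T k = 0 := k.2
  have hk1 : T' (ek k) = 0 := (ek k).2
  simp only [LinearEquiv.trans_apply, LinearEquiv.symm_apply_apply, LinearEquiv.prodCongr_apply]
  simp only [P, P', Submodule.coe_prodEquivOfIsCompl', map_add, hk0, hk1, hec]

theorem model_congr (p : ℕ) {q : ℕ} [Fact q.Prime] {K : Type} [Field K]
    (κ : Multiplicative (ZMod q) →* Kˣ) (m r e : ℕ)
    (T T' : (Fin e → ZMod q) →ₗ[ZMod q] (Fin m → ZMod q))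
    (h : LinearMap.range T = LinearMap.range T') :
    Nonempty (ModelGp p κ m r e T ≃* ModelGp p κ m r e T') := by
  obtain ⟨g, hg⟩ := exists_equiv_of_range_eq T T' h
  refine ⟨SemidirectProduct.congr (MulEquiv.refl _) (AddEquiv.toMultiplicative g.toAddEquiv) ?_⟩
  intro x
  have hx : T' (g x.toAdd) = T x.toAdd := hg _
  refine MulEquiv.ext fun v => ?_
  change stdAut p κ m r (Multiplicative.ofAdd (T x.toAdd)) v =
    stdAut p κ m r (Multiplicative.ofAdd (T' (g x.toAdd))) v
  rw [hx]

theorem rep_add {p q : ℕ} [Fact p.Prime] [Fact q.Prime] (hpq : p ≠ q)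
    {K : Type} [Field K] [Fintype K] [Algebra (ZMod p) K]
    (hK : Fintype.card K = p ^ orderOf (p : ZMod q))
    (κ : Multiplicative (ZMod q) →* Kˣ) (hκ : Function.Injective κ)
    {V E : Type} [AddCommGroup V] [AddCommGroup E] [Module (ZMod p) V] [Module (ZMod q) E]
    [Finite V] [Finite E] (F : E → V → V) (hFa : ∀ e u v, F e (u + v) = F e u + F e v)
    (hF1 : ∀ v, F 0 v = v) (hFm : ∀ x y v, F (x + y) v = F x (F y v)) :
    ∃ (m r : ℕ), r < orderOf (p : ZMod q) ∧
        ∃ (ψ : V ≃+ (Fin m → K) × (Fin r → ZMod p)) (χ : E →+ (Fin m → ZMod q)),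
          ∀ (e : E) (v : V), ψ (F e v) = stdAct κ (χ e) (ψ v) := by
  let ρ : Multiplicative E →* Module.End (ZMod p) V :=
    { toFun := fun x => AddMonoidHom.toZModLinearMap p (AddMonoidHom.mk' (F x.toAdd) (hFa _))
      map_one' := LinearMap.ext fun v => hF1 v
      map_mul' := fun x y => LinearMap.ext fun v => hFm _ _ v }
  let : Module (MonoidAlgebra (ZMod p) (Multiplicative E)) V :=
    Module.compHom V
      (MonoidAlgebra.lift (ZMod p) (Module.End (ZMod p) V) (Multiplicative E) ρ).toRingHom
  have hact : ∀ (e : E) (v : V),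
      MonoidAlgebra.of (ZMod p) (Multiplicative E) (Multiplicative.ofAdd e) • v = F e v := by
    intro x v
    change (MonoidAlgebra.lift (ZMod p) (Module.End (ZMod p) V) (Multiplicative E) ρ
      (MonoidAlgebra.of (ZMod p) (Multiplicative E) (Multiplicative.ofAdd x))) v =
        ρ (Multiplicative.ofAdd x) v
    rw [MonoidAlgebra.lift_of]
  obtain ⟨m, r, hr, ψ, χ, hψ⟩ := rep_decomp hpq hK κ hκ (E := E) (Nat.card V) V le_rfl
  refine ⟨m, r, hr, ψ, χ, fun e v => ?_⟩
  rw [← hψ, hact]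

theorem exists_coords (q : ℕ) [Fact q.Prime] (e : ℕ) (E : Type) [AddCommGroup E]
    [Module (ZMod q) E] [Finite E] (he : Nat.card E = q ^ e) :
    Nonempty ((Fin e → ZMod q) ≃+ E) := by
  have hq := Fact.out (p := q.Prime)
  have hfe : Module.finrank (ZMod q) (Fin e → ZMod q) = Module.finrank (ZMod q) E := by
    rw [Module.finrank_fin_fun]
    have : Fintype E := Fintype.ofFinite _
    have h1 := Module.card_eq_pow_finrank (K := ZMod q) (V := E)
    rw [← Nat.card_eq_fintype_card, he, ZMod.card] at h1
    exact Nat.pow_right_injective hq.two_le h1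
  exact ⟨(LinearEquiv.ofFinrankEq (R := ZMod q) _ _ hfe).toAddEquiv⟩

theorem semidirect_model {p q : ℕ} [Fact p.Prime] [Fact q.Prime] (hpq : p ≠ q)
    {K : Type} [Field K] [Fintype K] [Algebra (ZMod p) K]
    (hK : Fintype.card K = p ^ orderOf (p : ZMod q))
    (κ : Multiplicative (ZMod q) →* Kˣ) (hκ : Function.Injective κ)
    {V E : Type} [CommGroup V] [CommGroup E] [Finite V] [Finite E] (φ : E →* MulAut V)
    (hV : ∀ v : V, v ^ p = 1) (hE : ∀ x : E, x ^ q = 1) (a e : ℕ)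
    (ha : Nat.card V = p ^ a) (he : Nat.card E = q ^ e) :
    ∃ T, Nonempty (SemidirectProduct V E φ ≃*
      ModelGp p κ (a / orderOf (p : ZMod q)) (a % orderOf (p : ZMod q)) e T) := by
  classical
  have hp := Fact.out (p := p.Prime)
  have hq := Fact.out (p := q.Prime)
  let : Module (ZMod p) (Additive V) := AddCommGroup.zmodModule (fun v => hV v.toMul)
  let : Module (ZMod q) (Additive E) := AddCommGroup.zmodModule (fun v => hE v.toMul)
  have : Finite (Additive V) := inferInstanceAs (Finite V)
  have : Finite (Additive E) := inferInstanceAs (Finite E)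
  obtain ⟨m, r, hr, ψ, χ, hψ⟩ := rep_add hpq hK κ hκ (V := Additive V) (E := Additive E)
    (fun x v => Additive.ofMul (φ x.toMul v.toMul)) (by intro x u v; simp) (by intro v; simp)
    (by intro x y v; simp)
  have hcard : a = orderOf (p : ZMod q) * m + r := by
    have h1 := Nat.card_congr ψ.toEquiv
    have h2 : Nat.card (Additive V) = Nat.card V := rfl
    rw [h2, ha, Nat.card_prod, Nat.card_eq_fintype_card, Nat.card_eq_fintype_card,
      Fintype.card_fun, Fintype.card_fun, hK, ZMod.card, Fintype.card_fin, Fintype.card_fin, ← pow_mul, ← pow_add] at h1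
    exact Nat.pow_right_injective hp.two_le h1
  obtain ⟨hm, hr'⟩ : m = a / orderOf (p : ZMod q) ∧ r = a % orderOf (p : ZMod q) := by
    constructor
    · rw [hcard, Nat.mul_add_div (by omega), Nat.div_eq_of_lt hr, add_zero]
    · rw [hcard, Nat.mul_add_mod, Nat.mod_eq_of_lt hr]
  subst hm hr'
  obtain ⟨η⟩ := exists_coords q e (Additive E) he
  refine ⟨AddMonoidHom.toZModLinearMap q (χ.comp η.toAddMonoidHom), ⟨?_⟩⟩
  refine SemidirectProduct.congr (AddEquiv.toMultiplicativeRight ψ : V ≃* _)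
    (AddEquiv.toMultiplicativeRight η.symm : E ≃* _) ?_
  intro x
  refine MulEquiv.ext fun v => ?_
  have h1 := hψ (Additive.ofMul x) (Additive.ofMul v)
  change Multiplicative.ofAdd (ψ (Additive.ofMul (φ x v))) =
    Multiplicative.ofAdd (stdAct κ (χ (η (η.symm (Additive.ofMul x)))) (ψ (Additive.ofMul v)))
  rw [AddEquiv.apply_symm_apply, ← h1]
  rfl

theorem exists_kappa {p q : ℕ} [Fact p.Prime] [Fact q.Prime] (hpq : p ≠ q) :
    ∃ (K : Type) (_ : Field K) (_ : Fintype K) (_ : Algebra (ZMod p) K)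
      (κ : Multiplicative (ZMod q) →* Kˣ),
      Fintype.card K = p ^ orderOf (p : ZMod q) ∧ Function.Injective κ := by
  classical
  have hp := Fact.out (p := p.Prime)
  have hq := Fact.out (p := q.Prime)
  set d := orderOf (p : ZMod q) with hd
  have hpd : (p : ZMod q) ^ d = 1 := pow_orderOf_eq_one _
  have hd0 : d ≠ 0 := by
    have hu : IsUnit (p : ZMod q) := by
      rw [ZMod.isUnit_iff_coprime]
      exact (Nat.coprime_primes hp hq).2 hpq
    obtain ⟨u, hu⟩ := hu
    rw [hd, ← hu, orderOf_units]
    exact (orderOf_pos u).ne'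
  let K := GaloisField p d
  let : Fintype K := Fintype.ofFinite K
  have hK : Fintype.card K = p ^ d := by
    rw [← Nat.card_eq_fintype_card]; exact GaloisField.card p d hd0
  have h1 : q ∣ Nat.card Kˣ := by
    rw [Nat.card_units, Nat.card_eq_fintype_card, hK]
    rw [← ZMod.natCast_eq_zero_iff, Nat.cast_sub (Nat.one_le_pow _ _ hp.pos)]
    simp [hpd]
  obtain ⟨x, hx⟩ := exists_prime_orderOf_dvd_card' q h1
  let κ0 : ZMod q →+ Additive Kˣ := ZMod.lift q ⟨zmultiplesHom (Additive Kˣ) (Additive.ofMul x), by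
      change Additive.ofMul (x ^ (q : ℤ)) = 0
      rw [zpow_natCast, ← hx, pow_orderOf_eq_one]; rfl⟩
  let κ : Multiplicative (ZMod q) →* Kˣ := AddMonoidHom.toMultiplicativeLeft κ0
  refine ⟨K, inferInstance, inferInstance, inferInstance, κ, hK, ?_⟩
  rw [injective_iff_map_eq_one]
  intro a ha
  obtain ⟨z, hz⟩ := ZMod.intCast_surjective a.toAdd
  have h2 : κ a = x ^ z := by
    change (κ0 a.toAdd).toMul = _
    rw [← hz]
    simp only [κ0, ZMod.lift_coe]
    rfl
  rw [h2] at ha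
  have h3 := orderOf_dvd_iff_zpow_eq_one.2 ha
  rw [hx, ← ZMod.intCast_zmod_eq_zero_iff_dvd] at h3
  apply Multiplicative.toAdd.injective
  rw [← hz]
  simpa using h3

/-- Itô: if `G = AB` with `A`, `B` abelian, then commutators `[a,b]`, `[x,y]` commute. -/
theorem ito_comm {G : Type} [Group G] (A B : Subgroup G)
    (hA : ∀ a ∈ A, ∀ b ∈ A, a * b = b * a) (hB : ∀ a ∈ B, ∀ b ∈ B, a * b = b * a)
    (hAB : ∀ g : G, ∃ a ∈ A, ∃ b ∈ B, g = a * b)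
    (a : G) (ha : a ∈ A) (b : G) (hb : b ∈ B) (x : G) (hx : x ∈ A) (y : G) (hy : y ∈ B) :
    (a * b * a⁻¹ * b⁻¹) * (x * y * x⁻¹ * y⁻¹) = (x * y * x⁻¹ * y⁻¹) * (a * b * a⁻¹ * b⁻¹) := by
  have hBA : ∀ g : G, ∃ b ∈ B, ∃ a ∈ A, g = b * a := by
    intro g
    obtain ⟨a, ha, b, hb, h⟩ := hAB g⁻¹
    exact ⟨b⁻¹, B.inv_mem hb, a⁻¹, A.inv_mem ha, by rw [← inv_inv g, h, mul_inv_rev]⟩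
  have cA : ∀ a ∈ A, ∀ x ∈ A, a * x * a⁻¹ = x := by
    intro a ha x hx; rw [hA a ha x hx]; group
  have cB : ∀ a ∈ B, ∀ x ∈ B, a * x * a⁻¹ = x := by
    intro a ha x hx; rw [hB a ha x hx]; group
  have dA : ∀ a ∈ A, ∀ u ∈ A, ∀ v : G, a * (v * u) * a⁻¹ * (v * u)⁻¹ = a * v * a⁻¹ * v⁻¹ := by
    intro a ha u hu v
    have : a * (v * u) * a⁻¹ * (v * u)⁻¹ = a * v * a⁻¹ * (a * u * a⁻¹) * u⁻¹ * v⁻¹ := by group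
    rw [this, cA a ha u hu]; group
  have dB : ∀ b ∈ B, ∀ u ∈ B, ∀ v : G, (v * u) * b * (v * u)⁻¹ * b⁻¹ = v * b * v⁻¹ * b⁻¹ := by
    intro b hb u hu v
    have : (v * u) * b * (v * u)⁻¹ * b⁻¹ = v * (u * b * u⁻¹) * v⁻¹ * b⁻¹ := by group
    rw [this, cB u hu b hb]
  have key : ∀ x ∈ A, ∀ y ∈ B, (y * x) * (a * b * a⁻¹ * b⁻¹) * (y * x)⁻¹
      = (x * y) * (a * b * a⁻¹ * b⁻¹) * (x * y)⁻¹ := by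
    intro x hx y hy
    obtain ⟨b2, hb2, a2, ha2, h2⟩ := hBA (x * b * x⁻¹)
    obtain ⟨a3, ha3, b3, hb3, h3⟩ := hAB (y * a * y⁻¹)
    have e1 : (y * x) * (a * b * a⁻¹ * b⁻¹) * (y * x)⁻¹ = a3 * b2 * a3⁻¹ * b2⁻¹ := by
      have s1 : (y * x) * (a * b * a⁻¹ * b⁻¹) * (y * x)⁻¹ =
          y * ((x * a * x⁻¹) * (x * b * x⁻¹) * (x * a * x⁻¹)⁻¹ * (x * b * x⁻¹)⁻¹) * y⁻¹ := by group
      rw [s1, cA x hx a ha, h2, dA a ha a2 ha2]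
      have s2 : y * (a * b2 * a⁻¹ * b2⁻¹) * y⁻¹ =
        (y * a * y⁻¹) * (y * b2 * y⁻¹) * (y * a * y⁻¹)⁻¹ * (y * b2 * y⁻¹)⁻¹ := by group
      rw [s2, cB y hy b2 hb2, h3, dB b2 hb2 b3 hb3]
    have e2 : (x * y) * (a * b * a⁻¹ * b⁻¹) * (x * y)⁻¹ = a3 * b2 * a3⁻¹ * b2⁻¹ := by
      have s1 : (x * y) * (a * b * a⁻¹ * b⁻¹) * (x * y)⁻¹ =
          x * ((y * a * y⁻¹) * (y * b * y⁻¹) * (y * a * y⁻¹)⁻¹ * (y * b * y⁻¹)⁻¹) * x⁻¹ := by group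
      rw [s1, cB y hy b hb, h3, dB b hb b3 hb3]
      have s2 : x * (a3 * b * a3⁻¹ * b⁻¹) * x⁻¹ =
        (x * a3 * x⁻¹) * (x * b * x⁻¹) * (x * a3 * x⁻¹)⁻¹ * (x * b * x⁻¹)⁻¹ := by group
      rw [s2, cA x hx a3 ha3, h2, dA a3 ha3 a2 ha2]
    rw [e1, e2]
  have k := key x⁻¹ (A.inv_mem hx) y⁻¹ (B.inv_mem hy)
  generalize a * b * a⁻¹ * b⁻¹ = c at k ⊢
  have k2 : c = (x * y * x⁻¹ * y⁻¹)⁻¹ * c * (x * y * x⁻¹ * y⁻¹) := by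
    calc c = (x⁻¹ * y⁻¹)⁻¹ * ((x⁻¹ * y⁻¹) * c * (x⁻¹ * y⁻¹)⁻¹) * (x⁻¹ * y⁻¹) := by group
      _ = (x⁻¹ * y⁻¹)⁻¹ * ((y⁻¹ * x⁻¹) * c * (y⁻¹ * x⁻¹)⁻¹) * (x⁻¹ * y⁻¹) := by rw [k]
      _ = (x * y * x⁻¹ * y⁻¹)⁻¹ * c * (x * y * x⁻¹ * y⁻¹) := by group
  generalize x * y * x⁻¹ * y⁻¹ = z at k2 ⊢
  calc c * z = z * (z⁻¹ * c * z) := by group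
    _ = z * c := by rw [← k2]

/-- An abelian normal subgroup with abelian quotient. -/
theorem exists_metab {G : Type} [Group G] (A B : Subgroup G)
    (hA : ∀ a ∈ A, ∀ b ∈ A, a * b = b * a) (hB : ∀ a ∈ B, ∀ b ∈ B, a * b = b * a)
    (hAB : ∀ g : G, ∃ a ∈ A, ∃ b ∈ B, g = a * b) :
    ∃ N : Subgroup G, N.Normal ∧ (∀ a ∈ N, ∀ b ∈ N, a * b = b * a) ∧
      ∀ g h : G, g * h * g⁻¹ * h⁻¹ ∈ N := by
  let S : Set G := {c | ∃ a ∈ A, ∃ b ∈ B, c = a * b * a⁻¹ * b⁻¹}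
  let N := Subgroup.closure S
  have hS : ∀ a ∈ A, ∀ b ∈ B, a * b * a⁻¹ * b⁻¹ ∈ N := fun a ha b hb =>
    Subgroup.subset_closure ⟨a, ha, b, hb, rfl⟩
  have conjN : ∀ g : G, (∀ s ∈ S, g * s * g⁻¹ ∈ N) → ∀ s ∈ N, g * s * g⁻¹ ∈ N := by
    intro g h s hs
    have : N ≤ N.comap (MulAut.conj g).toMonoidHom := by
      rw [Subgroup.closure_le]
      intro s hs
      exact h s hs
    exact this hs
  have nA : ∀ g ∈ A, ∀ s ∈ N, g * s * g⁻¹ ∈ N := by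
    intro g hg
    apply conjN
    rintro _ ⟨a, ha, b, hb, rfl⟩
    have : g * (a * b * a⁻¹ * b⁻¹) * g⁻¹ = ((g * a) * b * (g * a)⁻¹ * b⁻¹) * (g * b * g⁻¹ * b⁻¹)⁻¹ := by group
    rw [this]
    exact N.mul_mem (hS _ (A.mul_mem hg ha) _ hb) (N.inv_mem (hS _ hg _ hb))
  have nB : ∀ g ∈ B, ∀ s ∈ N, g * s * g⁻¹ ∈ N := by
    intro g hg
    apply conjN
    rintro _ ⟨a, ha, b, hb, rfl⟩
    have : g * (a * b * a⁻¹ * b⁻¹) * g⁻¹ = (a * g * a⁻¹ * g⁻¹)⁻¹ * (a * (g * b) * a⁻¹ * (g * b)⁻¹) := by group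
    rw [this]
    exact N.mul_mem (N.inv_mem (hS _ ha _ hg)) (hS _ ha _ (B.mul_mem hg hb))
  have hN : N.Normal := by
    constructor
    intro s hs g
    obtain ⟨a, ha, b, hb, rfl⟩ := hAB g
    have : a * b * s * (a * b)⁻¹ = a * (b * s * b⁻¹) * a⁻¹ := by group
    rw [this]
    exact nA a ha _ (nB b hb _ hs)
  refine ⟨N, hN, ?_, ?_⟩
  · have h1 : N ≤ Subgroup.centralizer S := by
      rw [Subgroup.closure_le]
      rintro _ ⟨a, ha, b, hb, rfl⟩
      change _ ∈ Subgroup.centralizer S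
      rw [Subgroup.mem_centralizer_iff]
      rintro _ ⟨x, hx, y, hy, rfl⟩
      exact ito_comm A B hA hB hAB x hx y hy a ha b hb
    rw [← Subgroup.centralizer_closure] at h1
    intro a ha b hb
    exact (Subgroup.mem_centralizer_iff.1 (h1 ha) b hb).symm
  · intro g h
    rw [← QuotientGroup.eq_one_iff]
    have cAB : ∀ a ∈ A, ∀ b ∈ B, Commute (a : G ⧸ N) (b : G ⧸ N) := by
      intro a ha b hb
      have := (QuotientGroup.eq_one_iff _).2 (hS a ha b hb)
      simp only [QuotientGroup.mk_mul, QuotientGroup.mk_inv] at this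
      rw [mul_inv_eq_one, mul_inv_eq_iff_eq_mul] at this
      exact this
    have cAA : ∀ a ∈ A, ∀ b ∈ A, Commute (a : G ⧸ N) (b : G ⧸ N) := by
      intro a ha b hb
      change (a : G ⧸ N) * b = b * a
      rw [← QuotientGroup.mk_mul, hA a ha b hb, QuotientGroup.mk_mul]
    have cBB : ∀ a ∈ B, ∀ b ∈ B, Commute (a : G ⧸ N) (b : G ⧸ N) := by
      intro a ha b hb
      change (a : G ⧸ N) * b = b * a
      rw [← QuotientGroup.mk_mul, hB a ha b hb, QuotientGroup.mk_mul]
    obtain ⟨a, ha, b, hb, rfl⟩ := hAB g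
    obtain ⟨x, hx, y, hy, rfl⟩ := hAB h
    simp only [QuotientGroup.mk_mul, QuotientGroup.mk_inv]
    have : Commute ((a : G ⧸ N) * b) ((x : G ⧸ N) * y) :=
      Commute.mul_left (Commute.mul_right (cAA a ha x hx) (cAB a ha y hy))
        (Commute.mul_right (cAB x hx b hb).symm (cBB b hb y hy))
    rw [mul_inv_eq_one, mul_inv_eq_iff_eq_mul]
    exact this

/-- Complements in elementary abelian groups. -/
theorem exists_compl {G : Type} [Group G] [Finite G] (p : ℕ) (hp : p.Prime) (P D P1 : Subgroup G)
    (hc : ∀ a ∈ P, ∀ b ∈ P, a * b = b * a) (he : ∀ a ∈ P, a ^ p = 1)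
    (hD : D ≤ P) (hP1 : P1 ≤ P) (hsup : ∀ x ∈ P, ∃ d ∈ D, ∃ y ∈ P1, x = d * y) :
    ∃ P0 ≤ P1, D ⊓ P0 = ⊥ ∧ ∀ x ∈ P, ∃ d ∈ D, ∃ y ∈ P0, x = d * y := by
  obtain ⟨P0, hP0, hmax⟩ := Set.Finite.exists_maximal
    (s := {H : Subgroup G | H ≤ P1 ∧ D ⊓ H = ⊥}) (Set.toFinite _) ⟨⊥, bot_le, by simp⟩
  refine ⟨P0, hP0.1, hP0.2, ?_⟩
  have main : ∀ x ∈ P1, ∃ d ∈ D, ∃ y ∈ P0, x = d * y := by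
    intro x hx
    by_contra hcon
    let H : Subgroup G :=
      { carrier := {g | ∃ y ∈ P0, ∃ k : ℤ, g = y * x ^ k}
        one_mem' := ⟨1, P0.one_mem, 0, by simp⟩
        mul_mem' := by
          rintro _ _ ⟨y, hy, k, rfl⟩ ⟨z, hz, l, rfl⟩
          refine ⟨y * z, P0.mul_mem hy hz, k + l, ?_⟩
          have : x ^ k * z = z * x ^ k := hc _ (P.zpow_mem (hP1 hx) k) _ (hP1 (hP0.1 hz))
          calc y * x ^ k * (z * x ^ l) = y * (x ^ k * z) * x ^ l := by group
            _ = _ := by rw [this]; group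
        inv_mem' := by
          rintro _ ⟨y, hy, k, rfl⟩
          refine ⟨y⁻¹, P0.inv_mem hy, -k, ?_⟩
          have : y⁻¹ * x ^ (-k) = x ^ (-k) * y⁻¹ := hc _ (P.inv_mem (hP1 (hP0.1 hy))) _ (P.zpow_mem (hP1 hx) _)
          rw [this]; group }
    have hHmem : H ∈ {H : Subgroup G | H ≤ P1 ∧ D ⊓ H = ⊥} := by
      constructor
      · rintro _ ⟨y, hy, k, rfl⟩
        exact P1.mul_mem (hP0.1 hy) (P1.zpow_mem hx k)
      · rw [eq_bot_iff]
        rintro _ ⟨hd, ⟨y, hy, k, rfl⟩⟩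
        by_cases hk : (p : ℤ) ∣ k
        · obtain ⟨l, rfl⟩ := hk
          have h1 : x ^ ((p : ℤ) * l) = 1 := by
            rw [zpow_mul, zpow_natCast, he x (hP1 hx), one_zpow]
          rw [h1, mul_one] at hd ⊢
          have : y ∈ D ⊓ P0 := ⟨hd, hy⟩
          rw [hP0.2] at this
          exact this
        · exfalso
          have hcop : IsCoprime k (p : ℤ) := by
            rw [isCoprime_comm]
            exact (Prime.coprime_iff_not_dvd (Nat.prime_iff_prime_int.1 hp)).2 hk
          obtain ⟨u, v, huv⟩ := hcop
          have hx1 : x = (x ^ k) ^ u := by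
            rw [← zpow_mul]
            have : x = x ^ (k * u + p * v) := by
              rw [mul_comm k, mul_comm (p : ℤ), huv, zpow_one]
            rw [zpow_add, zpow_mul x p, zpow_natCast, he x (hP1 hx), one_zpow, mul_one] at this
            exact this
          apply hcon
          refine ⟨(y * x ^ k) ^ u, D.zpow_mem hd u, (y ^ u)⁻¹, P0.inv_mem (P0.zpow_mem hy u), ?_⟩
          have hcm : Commute y (x ^ k) := hc _ (hP1 (hP0.1 hy)) _ (P.zpow_mem (hP1 hx) k)
          rw [hcm.mul_zpow, ← hx1]
          have : y ^ u * x = x * y ^ u := hc _ (P.zpow_mem (hP1 (hP0.1 hy)) u) _ (hP1 hx)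
          rw [this]; group
    have hle : P0 ≤ H := fun y hy => ⟨y, hy, 0, by simp⟩
    have hHP := hmax hHmem hle
    have hxH : x ∈ H := ⟨1, P0.one_mem, 1, by simp⟩
    exact hcon ⟨1, D.one_mem, x, hHP hxH, by simp⟩
  intro x hx
  obtain ⟨d, hd, y, hy, rfl⟩ := hsup x hx
  obtain ⟨d', hd', y', hy', rfl⟩ := main y hy
  exact ⟨d * d', D.mul_mem hd hd', y', hy', by group⟩

/-- Averaging: if `P0` normalises the abelian group `Q` and acts trivially modulo `D`,
then `Q = D · C_Q(P0)`. -/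
theorem averaging {G : Type} [Group G] [Finite G] (q : ℕ) (P0 Q D : Subgroup G)
    (hc : ∀ a ∈ Q, ∀ b ∈ Q, a * b = b * a) (he : ∀ a ∈ Q, a ^ q = 1) (hD : D ≤ Q)
    (hn : ∀ g ∈ P0, ∀ x ∈ Q, g * x * g⁻¹ ∈ Q)
    (hcomm : ∀ g ∈ P0, ∀ x ∈ Q, g * x * g⁻¹ * x⁻¹ ∈ D)
    (hcop : Nat.Coprime (Nat.card P0) q) :
    ∀ x ∈ Q, ∃ d ∈ D, ∃ y ∈ Q ⊓ Subgroup.centralizer (P0 : Set G), x = d * y := by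
  classical
  intro x hx
  let : CommGroup Q := { (inferInstance : Group Q) with
    mul_comm := fun a b => Subtype.ext (hc _ a.2 _ b.2) }
  let : Fintype P0 := Fintype.ofFinite P0
  let cj : P0 → Q →* Q := fun g =>
    { toFun := fun x => ⟨g * x * g⁻¹, hn g g.2 x x.2⟩
      map_one' := Subtype.ext (by simp)
      map_mul' := fun a b => Subtype.ext (by simp) }
  have hcj : ∀ g h : P0, ∀ z, cj g (cj h z) = cj (g * h) z := by
    intro g h z
    apply Subtype.ext
    change (g : G) * (h * z * (h : G)⁻¹) * (g : G)⁻¹ = ((g * h : P0) : G) * z * ((g * h : P0) : G)⁻¹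
    push_cast; group
  let X : Q := ⟨x, hx⟩
  let y : Q := ∏ g : P0, cj g X
  have hy : ∀ h : P0, cj h y = y := by
    intro h
    change cj h (∏ g : P0, cj g X) = ∏ g : P0, cj g X
    rw [map_prod]
    refine Fintype.prod_equiv (Equiv.mulLeft h) _ _ (fun g => ?_)
    rw [hcj]; rfl
  let D' : Subgroup Q := D.subgroupOf Q
  have hyD : y * (X ^ Nat.card P0)⁻¹ ∈ D' := by
    have : y * (X ^ Nat.card P0)⁻¹ = ∏ g : P0, (cj g X * X⁻¹) := by
      rw [Finset.prod_mul_distrib, Finset.prod_const, Finset.card_univ, Nat.card_eq_fintype_card, inv_pow]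
    rw [this]
    refine Subgroup.prod_mem _ fun g _ => ?_
    rw [Subgroup.mem_subgroupOf]
    exact hcomm g g.2 x hx
  have hcop' : IsCoprime (Nat.card P0 : ℤ) (q : ℤ) := Nat.isCoprime_iff_coprime.2 hcop
  obtain ⟨u, v, huv⟩ := hcop'
  have hX : X = (X ^ Nat.card P0) ^ u := by
    rw [← zpow_natCast X, ← zpow_mul]
    have h1 : X = X ^ ((Nat.card P0 : ℤ) * u + q * v) := by
      rw [mul_comm _ u, mul_comm (q : ℤ), huv, zpow_one]
    have h2 : X ^ q = 1 := Subtype.ext (he x hx)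
    rw [zpow_add, zpow_mul X q, zpow_natCast X q, h2, one_zpow, mul_one] at h1
    exact h1
  have hX2 : X = ((y * (X ^ Nat.card P0)⁻¹) ^ u)⁻¹ * y ^ u := by
    rw [mul_zpow, mul_inv, mul_comm, ← mul_assoc, mul_inv_cancel, one_mul, inv_zpow, inv_inv, ← hX]
  refine ⟨(((y * (X ^ Nat.card P0)⁻¹) ^ u)⁻¹ : Q), ?_, ((y ^ u : Q) : G), ⟨(y ^ u).2, ?_⟩, congrArg Subtype.val hX2⟩
  · exact Subgroup.mem_subgroupOf.1 (D'.inv_mem (D'.zpow_mem hyD u))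
  · change _ ∈ Subgroup.centralizer (P0 : Set G)
    rw [Subgroup.mem_centralizer_iff]
    intro h hh
    have h1 : cj ⟨h, hh⟩ (y ^ u) = y ^ u := by rw [map_zpow, hy]
    have h2 : h * ((y ^ u : Q) : G) * h⁻¹ = ((y ^ u : Q) : G) := congrArg Subtype.val h1
    rw [mul_inv_eq_iff_eq_mul] at h2
    exact h2

theorem iso_of_decomp {G : Type} [Group G] [Finite G] (A B C D : Subgroup G)
    [A.Normal] [C.Normal]
    (hAC : ∀ a ∈ A, ∀ b ∈ C, a * b = b * a) (hAD : ∀ a ∈ A, ∀ b ∈ D, a * b = b * a)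
    (hBC : ∀ a ∈ B, ∀ b ∈ C, a * b = b * a) (hBD : ∀ a ∈ B, ∀ b ∈ D, a * b = b * a)
    (hgen : ∀ H : Subgroup G, A ≤ H → B ≤ H → C ≤ H → D ≤ H → H = ⊤)
    (hcard : Nat.card A * Nat.card B * (Nat.card C * Nat.card D) = Nat.card G) :
    Nonempty ((SemidirectProduct A B ((MulAut.conjNormal (H := A)).comp B.subtype)) ×
      (SemidirectProduct C D ((MulAut.conjNormal (H := C)).comp D.subtype)) ≃* G) := by
  let f1 : SemidirectProduct A B ((MulAut.conjNormal (H := A)).comp B.subtype) →* G :=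
    SemidirectProduct.lift A.subtype B.subtype (by
      intro g; ext x; simp [MulAut.conjNormal_apply])
  let f2 : SemidirectProduct C D ((MulAut.conjNormal (H := C)).comp D.subtype) →* G :=
    SemidirectProduct.lift C.subtype D.subtype (by
      intro g; ext x; simp [MulAut.conjNormal_apply])
  have hf1 : ∀ x, f1 x = (x.left : G) * x.right := fun x => by
    simp [f1, SemidirectProduct.lift]
  have hf2 : ∀ x, f2 x = (x.left : G) * x.right := fun x => by
    simp [f2, SemidirectProduct.lift]
  have hcomm : ∀ x y, Commute (f1 x) (f2 y) := by
    intro x y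
    rw [hf1, hf2]
    exact Commute.mul_left
      (Commute.mul_right (hAC _ x.left.2 _ y.left.2) (hAD _ x.left.2 _ y.right.2))
      (Commute.mul_right (hBC _ x.right.2 _ y.left.2) (hBD _ x.right.2 _ y.right.2))
  let F := MonoidHom.noncommCoprod f1 f2 hcomm
  have hF : ∀ x y, F (x, y) = f1 x * f2 y := fun x y => rfl
  have hsurj : Function.Surjective F := by
    rw [← MonoidHom.range_eq_top]
    apply hgen
    · intro x hx
      exact ⟨(⟨⟨x, hx⟩, 1⟩, 1), by rw [hF, hf1, map_one]; simp⟩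
    · intro x hx
      exact ⟨(⟨1, ⟨x, hx⟩⟩, 1), by rw [hF, hf1, map_one]; simp⟩
    · intro x hx
      exact ⟨(1, ⟨⟨x, hx⟩, 1⟩), by rw [hF, hf2, map_one]; simp⟩
    · intro x hx
      exact ⟨(1, ⟨1, ⟨x, hx⟩⟩), by rw [hF, hf2, map_one]; simp⟩
  have : Finite (SemidirectProduct A B ((MulAut.conjNormal (H := A)).comp B.subtype)) :=
    Finite.of_equiv _ SemidirectProduct.equivProd.symm
  have : Finite (SemidirectProduct C D ((MulAut.conjNormal (H := C)).comp D.subtype)) :=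
    Finite.of_equiv _ SemidirectProduct.equivProd.symm
  have hbij : Function.Bijective F := by
    rw [Nat.bijective_iff_surjective_and_card]
    refine ⟨hsurj, ?_⟩
    rw [Nat.card_prod, SemidirectProduct.card, SemidirectProduct.card, hcard]
  exact ⟨MulEquiv.ofBijective F hbij⟩

theorem card_of_compl {G : Type} [Group G] [Finite G] (P D E : Subgroup G)
    (hD : D ≤ P) (hE : E ≤ P) (hDE : D ⊓ E = ⊥)
    (h : ∀ x ∈ P, ∃ d ∈ D, ∃ y ∈ E, x = d * y) : Nat.card D * Nat.card E = Nat.card P := by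
  rw [← Nat.card_prod]
  refine Nat.card_eq_of_bijective
    (fun z : D × E => (⟨z.1 * z.2, P.mul_mem (hD z.1.2) (hE z.2.2)⟩ : P)) ⟨?_, ?_⟩
  · rintro ⟨a, b⟩ ⟨c, d⟩ hh
    have h1 : (a : G) * b = c * d := congrArg Subtype.val hh
    have h2 : (c : G)⁻¹ * a = d * (b : G)⁻¹ := by
      rw [inv_mul_eq_iff_eq_mul, ← mul_assoc, ← h1]; group
    have h3 : (c : G)⁻¹ * a ∈ D ⊓ E :=
      ⟨D.mul_mem (D.inv_mem c.2) a.2, h2 ▸ E.mul_mem d.2 (E.inv_mem b.2)⟩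
    rw [hDE, Subgroup.mem_bot] at h3
    rw [h3] at h2
    rw [inv_mul_eq_one] at h3
    exact Prod.ext (Subtype.ext h3.symm) (Subtype.ext (mul_inv_eq_one.1 h2.symm).symm)
  · rintro ⟨x, hx⟩
    obtain ⟨d, hd, y, hy, rfl⟩ := h x hx
    exact ⟨(⟨d, hd⟩, ⟨y, hy⟩), rfl⟩

theorem decomp {G : Type} [Group G] [Finite G] {p q : ℕ} [Fact p.Prime] [Fact q.Prime]
    (hpq : p ≠ q) (α β : ℕ) (hcard : Nat.card G = p ^ α * q ^ β)
    (hPc : ∀ P : Sylow p G, ∀ a ∈ P, ∀ b ∈ P, a * b = b * a) (hPe : ∀ P : Sylow p G, ∀ a ∈ P, a ^ p = 1)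
    (hQc : ∀ P : Sylow q G, ∀ a ∈ P, ∀ b ∈ P, a * b = b * a) (hQe : ∀ P : Sylow q G, ∀ a ∈ P, a ^ q = 1) :
    ∃ A B C D : Subgroup G, ∃ _ : A.Normal, ∃ _ : C.Normal,
      (∀ a ∈ A, ∀ b ∈ A, a * b = b * a) ∧ (∀ a ∈ B, ∀ b ∈ B, a * b = b * a) ∧
      (∀ a ∈ C, ∀ b ∈ C, a * b = b * a) ∧ (∀ a ∈ D, ∀ b ∈ D, a * b = b * a) ∧
      (∀ a ∈ A, a ^ p = 1) ∧ (∀ a ∈ B, a ^ q = 1) ∧ (∀ a ∈ C, a ^ q = 1) ∧ (∀ a ∈ D, a ^ p = 1) ∧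
      Nat.card A * Nat.card D = p ^ α ∧ Nat.card C * Nat.card B = q ^ β ∧
      Nonempty ((SemidirectProduct A B ((MulAut.conjNormal (H := A)).comp B.subtype)) ×
        (SemidirectProduct C D ((MulAut.conjNormal (H := C)).comp D.subtype)) ≃* G) := by
  have hp := Fact.out (p := p.Prime)
  have hq := Fact.out (p := q.Prime)
  have hcop : Nat.Coprime p q := (Nat.coprime_primes hp hq).2 hpq
  have hcop2 : Nat.Coprime (p ^ α) (q ^ β) := Nat.Coprime.pow _ _ hcop
  let P : Sylow p G := default
  let Q : Sylow q G := default
  have hPcard : Nat.card P = p ^ α := by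
    rw [Sylow.card_eq_multiplicity, hcard, Nat.factorization_mul (pow_ne_zero _ hp.ne_zero) (pow_ne_zero _ hq.ne_zero)]
    simp [hp.factorization, hq.factorization, hpq]
  have hQcard : Nat.card Q = q ^ β := by
    rw [Sylow.card_eq_multiplicity, hcard, Nat.factorization_mul (pow_ne_zero _ hp.ne_zero) (pow_ne_zero _ hq.ne_zero)]
    simp [hp.factorization, hq.factorization, hpq.symm]
  -- elements of prime power order
  have elP : ∀ x : G, x ^ p ^ α = 1 → x ^ p = 1 := by
    intro x hx
    have : IsPGroup p (Subgroup.zpowers x) := by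
      apply IsPGroup.of_card (n := (Nat.factorization (orderOf x)) p)
      rw [Nat.card_zpowers]
      obtain ⟨k, -, hk⟩ := (Nat.dvd_prime_pow hp).1 (orderOf_dvd_of_pow_eq_one hx)
      rw [hk]; simp [hp.factorization]
    obtain ⟨R, hR⟩ := this.exists_le_sylow
    exact hPe R x (hR (Subgroup.mem_zpowers x))
  have elQ : ∀ x : G, x ^ q ^ β = 1 → x ^ q = 1 := by
    intro x hx
    have : IsPGroup q (Subgroup.zpowers x) := by
      apply IsPGroup.of_card (n := (Nat.factorization (orderOf x)) q)
      rw [Nat.card_zpowers]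
      obtain ⟨k, -, hk⟩ := (Nat.dvd_prime_pow hq).1 (orderOf_dvd_of_pow_eq_one hx)
      rw [hk]; simp [hq.factorization]
    obtain ⟨R, hR⟩ := this.exists_le_sylow
    exact hQe R x (hR (Subgroup.mem_zpowers x))
  have hPQ : ∀ g : G, ∃ a ∈ (P : Subgroup G), ∃ b ∈ (Q : Subgroup G), g = a * b := by
    have hc := Subgroup.isComplement'_of_coprime (H := (P : Subgroup G)) (K := (Q : Subgroup G))
      (by rw [hcard]; exact congrArg₂ _ hPcard hQcard) (by
        have h1 : Nat.card (P : Subgroup G) = _ := hPcard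
        have h2 : Nat.card (Q : Subgroup G) = _ := hQcard
        rw [h1, h2]; exact hcop2)
    intro g
    obtain ⟨⟨a, b⟩, h⟩ := hc.2 g
    exact ⟨a, a.2, b, b.2, h.symm⟩
  obtain ⟨N, hN, hNc, hNq⟩ := exists_metab (P : Subgroup G) Q (hPc P) (hQc Q) hPQ
  have mkD : ∀ r : ℕ, ∃ D : Subgroup G, D.Normal ∧ ∀ x, x ∈ D ↔ x ∈ N ∧ x ^ r = 1 := by
    intro r
    refine ⟨{ carrier := {x | x ∈ N ∧ x ^ r = 1}
              one_mem' := ⟨N.one_mem, one_pow _⟩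
              mul_mem' := ?_
              inv_mem' := ?_ }, ⟨?_⟩, fun x => Iff.rfl⟩
    · rintro a b ⟨ha, ha'⟩ ⟨hb, hb'⟩
      refine ⟨N.mul_mem ha hb, ?_⟩
      have : Commute a b := hNc a ha b hb
      rw [this.mul_pow, ha', hb', one_mul]
    · rintro a ⟨ha, ha'⟩
      exact ⟨N.inv_mem ha, by rw [inv_pow, ha', inv_one]⟩
    · rintro a ⟨ha, ha'⟩ g
      exact ⟨hN.conj_mem a ha g, by rw [conj_pow, ha']; simp⟩
  obtain ⟨A, hAn, hA⟩ := mkD p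
  obtain ⟨C, hCn, hC⟩ := mkD q
  have hNdec : ∀ x ∈ N, ∃ u ∈ A, ∃ v ∈ C, x = u * v := by
    intro x hx
    have hb : IsCoprime ((p ^ α : ℕ) : ℤ) ((q ^ β : ℕ) : ℤ) := Nat.isCoprime_iff_coprime.2 hcop2
    obtain ⟨t, s, hts⟩ := hb
    have hx1 : x ^ (p ^ α * q ^ β) = 1 := by rw [← hcard]; exact pow_card_eq_one'
    refine ⟨(x ^ q ^ β) ^ s, (hA _).2 ⟨N.zpow_mem (N.pow_mem hx _) _, elP _ ?_⟩,
      (x ^ p ^ α) ^ t, (hC _).2 ⟨N.zpow_mem (N.pow_mem hx _) _, elQ _ ?_⟩, ?_⟩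
    · rw [← zpow_natCast, zpow_comm, zpow_natCast, ← pow_mul, mul_comm, hx1, one_zpow]
    · rw [← zpow_natCast, zpow_comm, zpow_natCast, ← pow_mul, hx1, one_zpow]
    · rw [← zpow_natCast x, ← zpow_natCast x, ← zpow_mul, ← zpow_mul, ← zpow_add, mul_comm, add_comm,
        mul_comm _ t, hts, zpow_one]
  have hAP : A ≤ P := by
    have hAp : IsPGroup p A := by
      intro x
      exact ⟨1, Subtype.ext (by rw [pow_one]; exact ((hA _).1 x.2).2)⟩
    obtain ⟨R, hR⟩ := hAp.exists_le_sylow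
    obtain ⟨g, hg⟩ := MulAction.exists_smul_eq G R P
    intro x hx
    have : g⁻¹ * x * g ∈ R := hR (by simpa using hAn.conj_mem x hx g⁻¹)
    rw [← hg]
    change x ∈ g • R
    rw [← SetLike.mem_coe, Sylow.coe_smul]
    exact ⟨g⁻¹ * x * g, this, by simp [mul_assoc]⟩
  have hCQ : C ≤ Q := by
    have hAp : IsPGroup q C := by
      intro x
      exact ⟨1, Subtype.ext (by rw [pow_one]; exact ((hC _).1 x.2).2)⟩
    obtain ⟨R, hR⟩ := hAp.exists_le_sylow
    obtain ⟨g, hg⟩ := MulAction.exists_smul_eq G R Q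
    intro x hx
    have : g⁻¹ * x * g ∈ R := hR (by simpa using hCn.conj_mem x hx g⁻¹)
    rw [← hg]
    change x ∈ g • R
    rw [← SetLike.mem_coe, Sylow.coe_smul]
    exact ⟨g⁻¹ * x * g, this, by simp [mul_assoc]⟩
  -- Frattini
  let NQ : Subgroup G := Subgroup.normalizer ((Q : Subgroup G) : Set G)
  have hQNQ : (Q : Subgroup G) ≤ NQ := Subgroup.le_normalizer
  have hfr : ∀ g : G, ∃ c ∈ NQ, ∃ u ∈ A, g = c * u := by
    have hHn : ((Q : Subgroup G) ⊔ N).Normal := by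
      constructor
      intro x hx g
      have h1 : g * x * g⁻¹ * x⁻¹ ∈ (Q : Subgroup G) ⊔ N := (le_sup_right : N ≤ _) (hNq g x)
      have := Subgroup.mul_mem _ h1 hx
      simpa using this
    have hf := Sylow.normalizer_sup_eq_top' Q (N := (Q : Subgroup G) ⊔ N) le_sup_left
    rw [← sup_assoc] at hf
    change NQ ⊔ (Q : Subgroup G) ⊔ N = ⊤ at hf
    rw [sup_eq_left.2 hQNQ] at hf
    intro g
    have hg : g ∈ NQ ⊔ N := by rw [hf]; trivial
    rw [Subgroup.mem_sup_of_normal_right] at hg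
    obtain ⟨c, hc, y, hy, rfl⟩ := hg
    obtain ⟨u, hu, v, hv, rfl⟩ := hNdec y hy
    refine ⟨c * v, NQ.mul_mem hc (hQNQ (hCQ hv)), u, hu, ?_⟩
    rw [hNc u ((hA _).1 hu).1 v ((hC _).1 hv).1, mul_assoc]
  obtain ⟨D, hD1, hAD, hDsup⟩ := exists_compl p hp (P : Subgroup G) A (P ⊓ NQ) (hPc P) (hPe P) hAP inf_le_left (by
    intro x hx
    obtain ⟨c, hc, u, hu, rfl⟩ := hfr x
    have hcP : c ∈ (P : Subgroup G) := by
      have := (P : Subgroup G).mul_mem hx ((P : Subgroup G).inv_mem (hAP hu))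
      simpa using this
    exact ⟨u, hu, c, ⟨hcP, hc⟩, hPc P _ hcP _ (hAP hu)⟩)
  have hDP : D ≤ P := hD1.trans inf_le_left
  have hDcard := card_of_compl _ A D hAP hDP hAD hDsup
  have hnorm : ∀ g ∈ D, ∀ x ∈ (Q : Subgroup G), g * x * g⁻¹ ∈ (Q : Subgroup G) := by
    intro g hg x hx
    exact (Subgroup.mem_normalizer_iff.1 (hD1 hg).2 x).1 hx
  have hav := averaging q D (Q : Subgroup G) C (hQc Q) (hQe Q) hCQ hnorm (by
    intro g hg x hx
    exact (hC _).2 ⟨hNq g x, hQe Q _ ((Q : Subgroup G).mul_mem (hnorm g hg x hx) ((Q : Subgroup G).inv_mem hx))⟩) (by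
    have h1 : Nat.card D ∣ p ^ α := by
      rw [← hPcard]; exact Subgroup.card_dvd_of_le hDP
    exact Nat.Coprime.coprime_dvd_left h1 (Nat.Coprime.pow_left _ hcop))
  obtain ⟨B, hB1, hCB, hBsup⟩ := exists_compl q hq (Q : Subgroup G) C _ (hQc Q) (hQe Q) hCQ inf_le_left hav
  have hBQ : B ≤ Q := hB1.trans inf_le_left
  have hBcard := card_of_compl _ C B hCQ hBQ hCB hBsup
  have hPcard' : Nat.card (P : Subgroup G) = p ^ α := hPcard
  have hQcard' : Nat.card (Q : Subgroup G) = q ^ β := hQcard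
  rw [hPcard'] at hDcard
  rw [hQcard'] at hBcard
  refine ⟨A, B, C, D, hAn, hCn, ?_, ?_, ?_, ?_, ?_, ?_, ?_, ?_, hDcard, hBcard, ?_⟩
  · exact fun a ha b hb => hPc P _ (hAP ha) _ (hAP hb)
  · exact fun a ha b hb => hQc Q _ (hBQ ha) _ (hBQ hb)
  · exact fun a ha b hb => hQc Q _ (hCQ ha) _ (hCQ hb)
  · exact fun a ha b hb => hPc P _ (hDP ha) _ (hDP hb)
  · exact fun a ha => hPe P _ (hAP ha)
  · exact fun a ha => hQe Q _ (hBQ ha)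
  · exact fun a ha => hQe Q _ (hCQ ha)
  · exact fun a ha => hPe P _ (hDP ha)
  · apply iso_of_decomp
    · exact fun a ha b hb => hNc _ ((hA _).1 ha).1 _ ((hC _).1 hb).1
    · exact fun a ha b hb => hPc P _ (hAP ha) _ (hDP hb)
    · exact fun a ha b hb => hQc Q _ (hBQ ha) _ (hCQ hb)
    · exact fun a ha b hb => (Subgroup.mem_centralizer_iff.1 (hB1 ha).2 b hb).symm
    · intro H h1 h2 h3 h4
      rw [eq_top_iff]
      intro g _
      obtain ⟨x, hx, y, hy, rfl⟩ := hPQ g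
      obtain ⟨a, ha, d, hd, rfl⟩ := hDsup x hx
      obtain ⟨c, hc, b, hb, rfl⟩ := hBsup y hy
      exact H.mul_mem (H.mul_mem (h1 ha) (h4 hd)) (H.mul_mem (h3 hc) (h2 hb))
    · rw [hcard, ← hDcard, ← hBcard]; ring

/-- Every group in the class is a product of two standard models. -/
theorem structure_model {p q : ℕ} [Fact p.Prime] [Fact q.Prime] (hpq : p ≠ q)
    {K : Type} [Field K] [Fintype K] [Algebra (ZMod p) K]
    (hK : Fintype.card K = p ^ orderOf (p : ZMod q))
    (κ : Multiplicative (ZMod q) →* Kˣ) (hκ : Function.Injective κ)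
    {L : Type} [Field L] [Fintype L] [Algebra (ZMod q) L]
    (hL : Fintype.card L = q ^ orderOf (q : ZMod p))
    (ι : Multiplicative (ZMod p) →* Lˣ) (hι : Function.Injective ι)
    {G : Type} [Group G] [Finite G] (α β : ℕ) (hcard : Nat.card G = p ^ α * q ^ β)
    (hP : ∀ P : Subgroup G, IsSylow' p P → ElemAbelian p P)
    (hQ : ∀ Q : Subgroup G, IsSylow' q Q → ElemAbelian q Q) :
    ∃ a b : ℕ, a ≤ α ∧ b ≤ β ∧ ∃ T T', Nonempty (G ≃*
      ModelGp p κ (a / orderOf (p : ZMod q)) (a % orderOf (p : ZMod q)) (β - b) T ×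
      ModelGp q ι (b / orderOf (q : ZMod p)) (b % orderOf (q : ZMod p)) (α - a) T') := by
  have hp := Fact.out (p := p.Prime)
  have hq := Fact.out (p := q.Prime)
  have hP' : ∀ P : Sylow p G, ElemAbelian p P := fun P =>
    hP P ⟨P.isPGroup', ((hp.coprime_iff_not_dvd).2 P.not_dvd_index).symm⟩
  have hQ' : ∀ P : Sylow q G, ElemAbelian q P := fun P =>
    hQ P ⟨P.isPGroup', ((hq.coprime_iff_not_dvd).2 P.not_dvd_index).symm⟩
  obtain ⟨A, B, C, D, hAn, hCn, hAc, hBc, hCc, hDc, hAe, hBe, hCe, hDe, hAD, hCB, ⟨f⟩⟩ :=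
    decomp hpq α β hcard
      (fun P a ha b hb => congrArg Subtype.val ((hP' P).1 ⟨a, ha⟩ ⟨b, hb⟩))
      (fun P a ha => congrArg Subtype.val ((hP' P).2 ⟨a, ha⟩))
      (fun P a ha b hb => congrArg Subtype.val ((hQ' P).1 ⟨a, ha⟩ ⟨b, hb⟩))
      (fun P a ha => congrArg Subtype.val ((hQ' P).2 ⟨a, ha⟩))
  obtain ⟨a, haα, ha⟩ := (Nat.dvd_prime_pow hp).1 (Dvd.intro _ hAD)
  obtain ⟨b, hbβ, hb⟩ := (Nat.dvd_prime_pow hq).1 (Dvd.intro _ hCB)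
  have hDcard : Nat.card D = p ^ (α - a) := by
    have h1 : p ^ a * p ^ (α - a) = p ^ α := by rw [← pow_add]; congr 1; omega
    rw [ha, ← h1] at hAD
    exact Nat.eq_of_mul_eq_mul_left (pow_pos hp.pos _) hAD
  have hBcard : Nat.card B = q ^ (β - b) := by
    have h1 : q ^ b * q ^ (β - b) = q ^ β := by rw [← pow_add]; congr 1; omega
    rw [hb, ← h1] at hCB
    exact Nat.eq_of_mul_eq_mul_left (pow_pos hq.pos _) hCB
  let : CommGroup A := { (inferInstance : Group A) with
    mul_comm := fun a b => Subtype.ext (hAc _ a.2 _ b.2) }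
  let : CommGroup B := { (inferInstance : Group B) with
    mul_comm := fun a b => Subtype.ext (hBc _ a.2 _ b.2) }
  let : CommGroup C := { (inferInstance : Group C) with
    mul_comm := fun a b => Subtype.ext (hCc _ a.2 _ b.2) }
  let : CommGroup D := { (inferInstance : Group D) with
    mul_comm := fun a b => Subtype.ext (hDc _ a.2 _ b.2) }
  obtain ⟨T, ⟨g⟩⟩ := semidirect_model hpq hK κ hκ ((MulAut.conjNormal (H := A)).comp B.subtype)
    (fun v => Subtype.ext (hAe _ v.2)) (fun v => Subtype.ext (hBe _ v.2)) a (β - b) ha hBcard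
  obtain ⟨T', ⟨g'⟩⟩ := semidirect_model hpq.symm hL ι hι ((MulAut.conjNormal (H := C)).comp D.subtype)
    (fun v => Subtype.ext (hCe _ v.2)) (fun v => Subtype.ext (hDe _ v.2)) b (α - a) hb hDcard
  exact ⟨a, b, haα, hbβ, T, T', ⟨f.symm.trans (MulEquiv.prodCongr g g')⟩⟩

/-- Combinatorial data classifying the groups of order `p^α q^β` in the class. -/
abbrev ClassData (p q α β : ℕ) [Fact p.Prime] [Fact q.Prime] : Type :=
  Σ ab : Fin (α + 1) × Fin (β + 1),
    {U : Submodule (ZMod q) (Fin (ab.1.1 / orderOf (p : ZMod q)) → ZMod q) //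
      Module.finrank (ZMod q) U ≤ β - ab.2.1} ×
    {U : Submodule (ZMod p) (Fin (ab.2.1 / orderOf (q : ZMod p)) → ZMod p) //
      Module.finrank (ZMod p) U ≤ α - ab.1.1}

/-- The group structure `g` is described by the data `x`. -/
def Described {p q α β : ℕ} [Fact p.Prime] [Fact q.Prime] {K L : Type} [Field K] [Field L]
    (κ : Multiplicative (ZMod q) →* Kˣ) (ι : Multiplicative (ZMod p) →* Lˣ)
    {X : Type} (g : Group X) (x : ClassData p q α β) : Prop :=
  letI := g
  ∃ T T', LinearMap.range T = x.2.1.1 ∧ LinearMap.range T' = x.2.2.1 ∧ Nonempty (X ≃*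
      ModelGp p κ (x.1.1.1 / orderOf (p : ZMod q)) (x.1.1.1 % orderOf (p : ZMod q)) (β - x.1.2.1) T ×
      ModelGp q ι (x.1.2.1 / orderOf (q : ZMod p)) (x.1.2.1 % orderOf (q : ZMod p)) (α - x.1.1.1) T')

theorem described_iso {p q α β : ℕ} [Fact p.Prime] [Fact q.Prime] {K L : Type} [Field K] [Field L]
    (κ : Multiplicative (ZMod q) →* Kˣ) (ι : Multiplicative (ZMod p) →* Lˣ)
    {X Y : Type} (g : Group X) (h : Group Y) (x : ClassData p q α β) (hg : Described κ ι g x)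
    (hh : Described κ ι h x) : GroupIsoOf g h := by
  obtain ⟨T, T', h1, h2, ⟨f⟩⟩ := hg
  obtain ⟨S, S', k1, k2, ⟨f'⟩⟩ := hh
  obtain ⟨m1⟩ := model_congr p κ _ (x.1.1.1 % orderOf (p : ZMod q)) _ T S (h1.trans k1.symm)
  obtain ⟨m2⟩ := model_congr q ι _ (x.1.2.1 % orderOf (q : ZMod p)) _ T' S' (h2.trans k2.symm)
  exact ⟨(f.trans (MulEquiv.prodCongr m1 m2)).trans f'.symm⟩

theorem exists_described {p q α β : ℕ} [Fact p.Prime] [Fact q.Prime] (hpq : p ≠ q)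
    {K : Type} [Field K] [Fintype K] [Algebra (ZMod p) K]
    (hK : Fintype.card K = p ^ orderOf (p : ZMod q))
    (κ : Multiplicative (ZMod q) →* Kˣ) (hκ : Function.Injective κ)
    {L : Type} [Field L] [Fintype L] [Algebra (ZMod q) L]
    (hL : Fintype.card L = q ^ orderOf (q : ZMod p))
    (ι : Multiplicative (ZMod p) →* Lˣ) (hι : Function.Injective ι)
    {X : Type} (g : Group X) [Finite X] (hcard : Nat.card X = p ^ α * q ^ β)
    (hP : ∀ P : Subgroup X, IsSylow' p P → ElemAbelian p P)
    (hQ : ∀ Q : Subgroup X, IsSylow' q Q → ElemAbelian q Q) :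
    ∃ x : ClassData p q α β, Described κ ι g x := by
  obtain ⟨a, b, ha, hb, T, T', ⟨f⟩⟩ := structure_model hpq hK κ hκ hL ι hι α β hcard hP hQ
  refine ⟨⟨(⟨a, by omega⟩, ⟨b, by omega⟩), ⟨LinearMap.range T, ?_⟩, ⟨LinearMap.range T', ?_⟩⟩,
    T, T', rfl, rfl, ⟨f⟩⟩
  · exact (LinearMap.finrank_range_le T).trans (by simp)
  · exact (LinearMap.finrank_range_le T').trans (by simp)

theorem numGroups_le (n : ℕ) (S : (G : Type) → Group G → Prop) (Y : Type) [Finite Y]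
    (R : Group (Fin n) → Y → Prop) (h1 : ∀ g, S (Fin n) g → ∃ y, R g y)
    (h2 : ∀ g h y, R g y → R h y → GroupIsoOf g h) : numGroups n S ≤ Nat.card Y := by
  choose F hF using fun g : {g : Group (Fin n) // S (Fin n) g} => h1 g.1 g.2
  refine Nat.card_le_card_of_injective (fun x => F (Quot.out x)) ?_
  intro x y hxy
  rw [← Quot.out_eq x, ← Quot.out_eq y]
  refine Quot.sound (h2 _ _ _ (hF _) ?_)
  have : F x.out = F y.out := hxy
  rw [this]; exact hF _

theorem le_muExp (p q α β : ℕ) (hp : p.Prime) (hq : q.Prime) (hpq : p ≠ q) :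
    α ≤ muExp (p ^ α * q ^ β) ∧ β ≤ muExp (p ^ α * q ^ β) := by
  have key : ∀ n r : ℕ, n.factorization r ≤ muExp n := by
    intro n r
    by_cases h : n.factorization r = 0
    · rw [h]; exact Nat.zero_le _
    · exact Finset.le_sup (f := n.factorization) (Finsupp.mem_support_iff.2 h)
  have hf := Nat.factorization_mul (pow_ne_zero α hp.ne_zero) (pow_ne_zero β hq.ne_zero)
  constructor
  · have h := key (p ^ α * q ^ β) p
    rw [hf] at h
    simpa [hp.factorization, hq.factorization, hpq] using h
  · have h := key (p ^ α * q ^ β) q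
    rw [hf] at h
    simpa [hp.factorization, hq.factorization, hpq.symm] using h

/-- Number of subspaces occurring on one side. -/
theorem side_bound (p q : ℕ) [Fact p.Prime] [Fact q.Prime] (a e : ℕ) (c μ : ℝ)
    (hc : cpq p q ≤ c) (hμ : (a : ℝ) ≤ μ) :
    (Nat.card {U : Submodule (ZMod q) (Fin (a / orderOf (p : ZMod q)) → ZMod q) //
      Module.finrank (ZMod q) U ≤ e} : ℝ) ≤
      2 ^ a * Real.exp (c * μ * (a * Real.log p + e * Real.log q)) := by
  have hp := Fact.out (p := p.Prime)
  have hq := Fact.out (p := q.Prime)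
  have hlp : 0 < Real.log p := Real.log_pos (by exact_mod_cast hp.one_lt)
  have hlq : 0 < Real.log q := Real.log_pos (by exact_mod_cast hq.one_lt)
  have h0 := cpq_nonneg p q hp hq
  have ha0 : (0 : ℝ) ≤ a := Nat.cast_nonneg a
  refine (card_subspaces q (a / orderOf (p : ZMod q)) e
    (Real.exp (c * μ * (a * Real.log p + e * Real.log q))) ?_).trans ?_
  · intro k hk
    have h1 := cpq_bound p q hp hq a k
    have hq0 : (0 : ℝ) < q := by exact_mod_cast hq.pos
    rw [Nat.cast_pow, ← Real.exp_log (pow_pos hq0 _), Real.log_pow]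
    apply Real.exp_le_exp.2
    refine h1.trans ?_
    have hk' : (k : ℝ) ≤ e := by exact_mod_cast hk
    have h2 : cpq p q * a ≤ c * μ := mul_le_mul hc hμ ha0 (h0.trans hc)
    gcongr
    exact (mul_nonneg h0 ha0).trans h2
  · gcongr
    · norm_num
    · exact Nat.div_le_self _ _

theorem card_classData (p q α β : ℕ) [Fact p.Prime] [Fact q.Prime] (c μ : ℝ)
    (hc : cpq p q ≤ c) (hc' : cpq q p ≤ c) (hα : (α : ℝ) ≤ μ) (hβ : (β : ℝ) ≤ μ) :
    (Nat.card (ClassData p q α β) : ℝ) ≤ ((p ^ α * q ^ β : ℕ) : ℝ) ^ (c * μ + 2) := by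
  have hp := Fact.out (p := p.Prime)
  have hq := Fact.out (p := q.Prime)
  have hp0 : (0 : ℝ) < p := by exact_mod_cast hp.pos
  have hq0 : (0 : ℝ) < q := by exact_mod_cast hq.pos
  set n : ℕ := p ^ α * q ^ β with hn
  have hn0 : (0 : ℝ) < n := by rw [hn]; push_cast; positivity
  have hlog : Real.log n = α * Real.log p + β * Real.log q := by
    rw [hn]; push_cast
    rw [Real.log_mul (by positivity) (by positivity), Real.log_pow, Real.log_pow]
  have hterm : ∀ ab : Fin (α + 1) × Fin (β + 1),
      (Nat.card ({U : Submodule (ZMod q) (Fin (ab.1.1 / orderOf (p : ZMod q)) → ZMod q) //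
      Module.finrank (ZMod q) U ≤ β - ab.2.1} ×
    {U : Submodule (ZMod p) (Fin (ab.2.1 / orderOf (q : ZMod p)) → ZMod p) //
      Module.finrank (ZMod p) U ≤ α - ab.1.1}) : ℝ) ≤ 2 ^ (α + β) * (n : ℝ) ^ (c * μ) := by
    rintro ⟨⟨a, ha⟩, ⟨b, hb⟩⟩
    have ha' : a ≤ α := by omega
    have hb' : b ≤ β := by omega
    rw [Nat.card_prod, Nat.cast_mul]
    have h1 := side_bound p q a (β - b) c μ hc (le_trans (by exact_mod_cast ha') hα)
    have h2 := side_bound q p b (α - a) c μ hc' (le_trans (by exact_mod_cast hb') hβ)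
    refine (mul_le_mul h1 h2 (Nat.cast_nonneg _) (by positivity)).trans ?_
    have e1 : ∀ x y : ℝ, 2 ^ a * Real.exp x * (2 ^ b * Real.exp y) =
        2 ^ (a + b) * Real.exp (x + y) := by
      intro x y; rw [Real.exp_add, pow_add]; ring
    rw [e1, Real.rpow_def_of_pos hn0, hlog]
    have e2 : c * μ * (a * Real.log p + (β - b : ℕ) * Real.log q) +
        c * μ * (b * Real.log q + (α - a : ℕ) * Real.log p) =
        (α * Real.log p + β * Real.log q) * (c * μ) := by
      rw [Nat.cast_sub ha', Nat.cast_sub hb']; ring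
    rw [e2]
    gcongr
    norm_num
  rw [Nat.card_sigma, Nat.cast_sum]
  refine (Finset.sum_le_sum fun ab _ => hterm ab).trans ?_
  rw [Finset.sum_const, Finset.card_univ, Fintype.card_prod, Fintype.card_fin, Fintype.card_fin,
    nsmul_eq_mul, Real.rpow_add hn0]
  have h2n : (2 : ℝ) ^ (α + β) ≤ n := by
    rw [hn, pow_add]; push_cast
    have : (2 : ℝ) ≤ p := by exact_mod_cast hp.two_le
    have : (2 : ℝ) ≤ q := by exact_mod_cast hq.two_le
    gcongr
  have hab : (((α + 1) * (β + 1) : ℕ) : ℝ) ≤ 2 ^ (α + β) := by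
    have h1 : α + 1 ≤ 2 ^ α := Nat.lt_two_pow_self
    have h2 : β + 1 ≤ 2 ^ β := Nat.lt_two_pow_self
    have := Nat.mul_le_mul h1 h2
    rw [← pow_add] at this
    exact_mod_cast this
  have h3 : (n : ℝ) ^ (2 : ℝ) = n * n := by
    rw [show (2 : ℝ) = ((2 : ℕ) : ℝ) by norm_num, Real.rpow_natCast, sq]
  rw [h3]
  have hr : 0 ≤ (n : ℝ) ^ (c * μ) := Real.rpow_nonneg hn0.le _
  calc (((α + 1) * (β + 1) : ℕ) : ℝ) * (2 ^ (α + β) * (n : ℝ) ^ (c * μ))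
      ≤ n * (n * (n : ℝ) ^ (c * μ)) := by
        gcongr
        exact_mod_cast hab.trans h2n
    _ = _ := by ring

/-- Let `𝔙` be the class of finite groups of order `p^α q^β` whose Sylow
`p`- and `q`-subgroups are abelian of exponent dividing `p` and `q` respectively.  Then
`f_𝔙(n) ≤ n^{d·μ(n) + 2}` where `d = max{c_{p,q}, c_{q,p}}`. -/
theorem join_variety_count_upper_bound (p q : ℕ) (hp : p.Prime) (hq : q.Prime)
    (hpq : p ≠ q) (n : ℕ) (hn : 1 ≤ n) :
    (numGroups n (fun G g => letI := g;
        (∃ α β : ℕ, Nat.card G = p ^ α * q ^ β) ∧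
        (∀ P : Subgroup G, IsSylow' p P → ElemAbelian p P) ∧
        ∀ Q : Subgroup G, IsSylow' q Q → ElemAbelian q Q) : ℝ) ≤
      (n : ℝ) ^ (max (cpq p q) (cpq q p) * (muExp n : ℝ) + 2) := by
  have : Fact p.Prime := ⟨hp⟩
  have : Fact q.Prime := ⟨hq⟩
  by_cases hex : ∃ α β : ℕ, n = p ^ α * q ^ β
  · obtain ⟨α, β, rfl⟩ := hex
    obtain ⟨K, _, _, _, κ, hK, hκ⟩ := exists_kappa hpq
    obtain ⟨L, _, _, _, ι, hL, hι⟩ := exists_kappa hpq.symm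
    obtain ⟨hα, hβ⟩ := le_muExp p q α β hp hq hpq
    refine le_trans ?_ (card_classData p q α β (max (cpq p q) (cpq q p))
      (muExp (p ^ α * q ^ β) : ℝ) (le_max_left _ _) (le_max_right _ _)
      (by exact_mod_cast hα) (by exact_mod_cast hβ))
    refine Nat.cast_le.2 (numGroups_le _ _ (ClassData p q α β) (Described κ ι) ?_ ?_)
    · rintro g ⟨-, h1, h2⟩
      exact exists_described hpq hK κ hκ hL ι hι g (by simp) h1 h2
    · exact fun g h y => described_iso κ ι g h y
  · have h0 : numGroups n (fun G g => letI := g;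
        (∃ α β : ℕ, Nat.card G = p ^ α * q ^ β) ∧
        (∀ P : Subgroup G, IsSylow' p P → ElemAbelian p P) ∧
        ∀ Q : Subgroup G, IsSylow' q Q → ElemAbelian q Q) ≤ Nat.card Empty := by
      refine numGroups_le _ _ Empty (fun _ _ => False) ?_ ?_
      · rintro g ⟨⟨α, β, h⟩, -⟩
        exact absurd ⟨α, β, by simpa using h⟩ hex
      · exact fun _ _ y => y.elim
    rw [Nat.card_of_isEmpty, Nat.le_zero] at h0
    rw [h0, Nat.cast_zero]
    positivity
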